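/- arXiv:1504.07199 — 6 statements merged into one kernel-verified Lean document; each statement's English description precedes it below -/
import Mathlib

section
/- Let T > 0 and let f : (ℝ/Tℤ) × ℝ × ℝ → ℝ be C¹. Suppose h₁, h₂ : ℝ/Tℤ → ℝ are C² functions with h₁(t) < h₂(t), |ḣ₁(t)| < 1 and |ḣ₂(t)| < 1 for all t, satisfying (1 − ḣ₁(t)²)^{3/2} f(t, h₁(t), ḣ₁(t)) − ḧ₁(t) < 0 and (1 − ḣ₂(t)²)^{3/2} f(t, h₂(t), ḣ₂(t)) − ḧ₂(t) > 0 for all t ∈ ℝ/Tℤ. Then there exists a T-periodic C² function q : ℝ → ℝ with |q̇(t)| < 1 solving the relativistic equation d/dt ( q̇ / √(1 − q̇²) ) = f(t, q, q̇) for all t, and moreover h₁(t) < q(t) < h₂(t) for all t. -/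
open Set MeasureTheory

/-- The bounded solution of `a' = r - k a`, as an exponentially weighted mean of the past of `r`. -/
noncomputable def expMean (k : ℝ) (r : ℝ → ℝ) (t : ℝ) : ℝ :=
  Real.exp (-(k * t)) * ∫ s in Iic t, Real.exp (k * s) * r s

lemma integrableOn_exp_mul_of_bounded {k B : ℝ} (hk : 0 < k) {r : ℝ → ℝ} (hr : Continuous r)
    (hB : ∀ t, |r t| ≤ B) (t : ℝ) : IntegrableOn (fun s => Real.exp (k * s) * r s) (Iic t) := by
  refine Integrable.mono' ((integrableOn_exp_mul_Iic hk t).mul_const B)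
    (by fun_prop) (ae_of_all _ fun s => ?_)
  rw [Real.norm_eq_abs, abs_mul, Real.abs_exp]
  exact mul_le_mul_of_nonneg_left (hB s) (Real.exp_pos _).le

lemma abs_expMean_le {k B : ℝ} (hk : 0 < k) {r : ℝ → ℝ}
    (hB : ∀ t, |r t| ≤ B) (t : ℝ) : |expMean k r t| ≤ B / k := by
  have h : ‖∫ s in Iic t, Real.exp (k * s) * r s‖ ≤ ∫ s in Iic t, Real.exp (k * s) * B := by
    refine norm_integral_le_of_norm_le ((integrableOn_exp_mul_Iic hk t).mul_const B)
      (ae_of_all _ fun s => ?_)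
    rw [Real.norm_eq_abs, abs_mul, Real.abs_exp]
    exact mul_le_mul_of_nonneg_left (hB s) (Real.exp_pos _).le
  rw [integral_mul_const, integral_exp_mul_Iic hk, Real.norm_eq_abs] at h
  rw [expMean, abs_mul, Real.abs_exp]
  calc _ ≤ Real.exp (-(k * t)) * (Real.exp (k * t) / k * B) := by gcongr
    _ = (Real.exp (-(k * t)) * Real.exp (k * t)) * (B / k) := by ring
    _ = B / k := by rw [← Real.exp_add]; simp

lemma expMean_sub {k B C : ℝ} (hk : 0 < k) {r s : ℝ → ℝ} (hr : Continuous r) (hs : Continuous s)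
    (hB : ∀ t, |r t| ≤ B) (hC : ∀ t, |s t| ≤ C) (t : ℝ) :
    expMean k r t - expMean k s t = expMean k (fun x => r x - s x) t := by
  simp only [expMean, mul_sub]
  rw [integral_sub (integrableOn_exp_mul_of_bounded hk hr hB t)
    (integrableOn_exp_mul_of_bounded hk hs hC t)]
  ring

lemma hasDerivAt_expMean {k B : ℝ} (hk : 0 < k) {r : ℝ → ℝ} (hr : Continuous r)
    (hB : ∀ t, |r t| ≤ B) (t : ℝ) :
    HasDerivAt (expMean k r) (r t - k * expMean k r t) t := by
  have hi := integrableOn_exp_mul_of_bounded hk hr hB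
  have hc : Continuous fun s => Real.exp (k * s) * r s := by fun_prop
  have h1 : HasDerivAt (fun x => ∫ s in Iic x, Real.exp (k * s) * r s)
      (Real.exp (k * t) * r t) t := by
    have h := (intervalIntegral.integral_hasDerivAt_right (hc.intervalIntegrable 0 t)
      hc.aestronglyMeasurable.stronglyMeasurableAtFilter hc.continuousAt).add_const
        (∫ s in Iic (0 : ℝ), Real.exp (k * s) * r s)
    refine h.congr_of_eventuallyEq (Filter.Eventually.of_forall fun x => ?_)
    have := intervalIntegral.integral_Iic_sub_Iic (hi 0) (hi x)
    simp only
    linarith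
  have h2 : HasDerivAt (fun x => Real.exp (-(k * x))) (Real.exp (-(k * t)) * (-(k * 1))) t :=
    ((hasDerivAt_id t).const_mul k).neg.exp
  refine (h2.mul h1).congr_deriv ?_
  rw [expMean, ← mul_assoc, ← Real.exp_add]
  simp
  ring

lemma expMean_comp_add (k : ℝ) (r : ℝ → ℝ) (c t : ℝ) :
    expMean k (fun x => r (x + c)) t = expMean k r (t + c) := by
  have h := (measurePreserving_add_right volume c).setIntegral_preimage_emb
    (measurableEmbedding_addRight c) (fun s => Real.exp (k * s) * r s) (Iic (t + c))
  simp only [preimage_add_const_Iic, add_sub_cancel_right] at h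
  rw [expMean, expMean, ← h]
  simp only [mul_add, Real.exp_add, neg_add]
  rw [← integral_const_mul, ← integral_const_mul]
  refine integral_congr_ae (ae_of_all _ fun s => ?_)
  have : Real.exp (-(k * c)) * Real.exp (k * c) = 1 := by rw [← Real.exp_add]; simp
  simp only
  linear_combination -(Real.exp (-(k * t)) * Real.exp (k * s) * r (s + c)) * this

/-- For bounded `r`, the derivative of the bounded solution of `u'' = r + k ^ 2 * u`. -/
noncomputable def greenDeriv (k : ℝ) (r : ℝ → ℝ) (t : ℝ) : ℝ :=
  (expMean k r t - expMean k (fun x => r (-x)) (-t)) / 2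

/-- For bounded `r`, the bounded solution of `u'' = r + k ^ 2 * u`. -/
noncomputable def greenSol (k : ℝ) (r : ℝ → ℝ) (t : ℝ) : ℝ :=
  -(expMean k r t + expMean k (fun x => r (-x)) (-t)) / (2 * k)

section Green

variable {k B : ℝ} {r : ℝ → ℝ}

lemma hasDerivAt_expMean_neg (hk : 0 < k) (hr : Continuous r) (hB : ∀ t, |r t| ≤ B) (t : ℝ) :
    HasDerivAt (fun t => expMean k (fun x => r (-x)) (-t))
      (k * expMean k (fun x => r (-x)) (-t) - r t) t := by
  have h := (hasDerivAt_expMean hk (hr.comp continuous_neg) (fun t => hB (-t)) (-t)).comp t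
    (hasDerivAt_neg t)
  refine h.congr_deriv ?_
  simp [Function.comp_def]

lemma hasDerivAt_greenSol (hk : 0 < k) (hr : Continuous r) (hB : ∀ t, |r t| ≤ B) (t : ℝ) :
    HasDerivAt (greenSol k r) (greenDeriv k r t) t := by
  refine (((hasDerivAt_expMean hk hr hB t).add
    (hasDerivAt_expMean_neg hk hr hB t)).neg.div_const (2 * k)).congr_deriv ?_
  rw [greenDeriv]
  field_simp
  ring

lemma hasDerivAt_greenDeriv (hk : 0 < k) (hr : Continuous r) (hB : ∀ t, |r t| ≤ B) (t : ℝ) :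
    HasDerivAt (greenDeriv k r) (r t + k ^ 2 * greenSol k r t) t := by
  refine (((hasDerivAt_expMean hk hr hB t).sub
    (hasDerivAt_expMean_neg hk hr hB t)).div_const 2).congr_deriv ?_
  rw [greenSol]
  field_simp
  ring

lemma abs_greenDeriv_le (hk : 0 < k) (hB : ∀ t, |r t| ≤ B) (t : ℝ) :
    |greenDeriv k r t| ≤ B / k := by
  have h1 := abs_le.1 (abs_expMean_le hk hB t)
  have h2 := abs_le.1 (abs_expMean_le hk (fun t => hB (-t)) (-t))
  rw [greenDeriv, abs_le]
  constructor <;> linarith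

lemma greenDeriv_sub {C : ℝ} {s : ℝ → ℝ} (hk : 0 < k) (hr : Continuous r) (hs : Continuous s)
    (hB : ∀ t, |r t| ≤ B) (hC : ∀ t, |s t| ≤ C) (t : ℝ) :
    greenDeriv k r t - greenDeriv k s t = greenDeriv k (fun x => r x - s x) t := by
  simp only [greenDeriv]
  rw [← expMean_sub hk hr hs hB hC, ← expMean_sub (r := fun x => r (-x)) (s := fun x => s (-x)) hk
    (hr.comp continuous_neg) (hs.comp continuous_neg) (fun t => hB (-t)) (fun t => hC (-t))]
  ring

lemma expMean_neg_comp_add (k : ℝ) (r : ℝ → ℝ) (c t : ℝ) :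
    expMean k (fun x => r (-x + c)) (-t) = expMean k (fun x => r (-x)) (-(t + c)) := by
  have := expMean_comp_add k (fun x => r (-x)) (-c) (-t)
  simpa [neg_add, add_comm] using this

lemma greenDeriv_comp_add (k : ℝ) (r : ℝ → ℝ) (c t : ℝ) :
    greenDeriv k (fun x => r (x + c)) t = greenDeriv k r (t + c) := by
  rw [greenDeriv, greenDeriv, expMean_comp_add, expMean_neg_comp_add]

lemma greenSol_comp_add (k : ℝ) (r : ℝ → ℝ) (c t : ℝ) :
    greenSol k (fun x => r (x + c)) t = greenSol k r (t + c) := by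
  rw [greenSol, greenSol, expMean_comp_add, expMean_neg_comp_add]

end Green

/-- The first and second order conditions at a global maximum of a periodic function. -/
lemma exists_max_of_periodic {T : ℝ} (hT : 0 < T) {d d' d'' : ℝ → ℝ}
    (hp : Function.Periodic d T) (h1 : ∀ t, HasDerivAt d (d' t) t)
    (h2 : ∀ t, HasDerivAt d' (d'' t) t) :
    ∃ t₀, (∀ t, d t ≤ d t₀) ∧ d' t₀ = 0 ∧ d'' t₀ ≤ 0 := by
  have hc : Continuous d := continuous_iff_continuousAt.2 fun t => (h1 t).continuousAt
  obtain ⟨t₀, -, hmax⟩ := isCompact_Icc.exists_isMaxOn (nonempty_Icc.2 hT.le) hc.continuousOn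
  have hmax' : ∀ t, d t ≤ d t₀ := fun t => by
    obtain ⟨y, hy, hty⟩ := hp.exists_mem_Ico₀ hT t
    exact hty ▸ hmax (Ico_subset_Icc_self hy)
  have hloc : IsLocalMax d t₀ := Filter.Eventually.of_forall hmax'
  have hd' : d' t₀ = 0 := hloc.hasDerivAt_eq_zero (h1 t₀)
  have hderiv : deriv d = d' := funext fun t => (h1 t).deriv
  refine ⟨t₀, hmax', hd', not_lt.1 fun hpos => ?_⟩
  have hmin : IsLocalMin d t₀ := isLocalMin_of_deriv_deriv_pos
    (by rwa [hderiv, (h2 t₀).deriv]) (by rw [hderiv, hd']) hc.continuousAt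
  have hconst : d =ᶠ[nhds t₀] fun _ => d t₀ := hmin.mono fun t ht => le_antisymm (hmax' t) ht
  have := hconst.deriv.deriv_eq
  rw [hderiv, (h2 t₀).deriv] at this
  simp at this
  linarith

lemma continuous_comp_triple {X : Type*} [TopologicalSpace X] {F : ℝ → ℝ → ℝ → ℝ}
    (hF : Continuous fun x : ℝ × ℝ × ℝ => F x.1 x.2.1 x.2.2) {a b c : X → ℝ}
    (ha : Continuous a) (hb : Continuous b) (hc : Continuous c) :
    Continuous fun x => F (a x) (b x) (c x) :=
  hF.comp (ha.prodMk (hb.prodMk hc))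

lemma abs_sub_le_of_hasDerivAt {u v : ℝ → ℝ} {K : ℝ} (hu : ∀ t, HasDerivAt u (v t) t)
    (hv : ∀ t, |v t| ≤ K) (a b : ℝ) : |u a - u b| ≤ K * |a - b| :=
  convex_univ.norm_image_sub_le_of_norm_hasDerivWithin_le
    (fun x _ => (hu x).hasDerivWithinAt) (fun x _ => hv x) (mem_univ b) (mem_univ a)

lemma continuous_of_abs_sub_le {w : ℝ → ℝ} {K : ℝ} (h : ∀ a b, |w a - w b| ≤ K * |a - b|) :
    Continuous w :=
  (LipschitzWith.of_dist_le' (K := K) fun a b => by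
    simpa only [Real.dist_eq] using h a b).continuous

section Periodic

variable {T L M : ℝ} {G : ℝ → ℝ → ℝ → ℝ}

open BoundedContinuousFunction in
/-- Solvability of the linearly coercive periodic problem with frozen state `w`. -/
lemma exists_periodic_frozen (hG : Continuous fun x : ℝ × ℝ × ℝ => G x.1 x.2.1 x.2.2)
    (hper : ∀ t q v, G (t + T) q v = G t q v) (hM : ∀ t q v, |G t q v| ≤ M) (hL : 0 ≤ L)
    (hlip : ∀ t q q' v v', |G t q v - G t q' v'| ≤ L * (|q - q'| + |v - v'|))
    {k R : ℝ} (hk : L < k) {w : ℝ → ℝ} (hw : Continuous w) (hwp : Function.Periodic w T)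
    (hwR : ∀ t, |w t| ≤ R) :
    ∃ u v : ℝ → ℝ, Function.Periodic u T ∧ (∀ t, HasDerivAt u (v t) t) ∧
      (∀ t, HasDerivAt v (G t (w t) (v t) + k ^ 2 * (u t - w t)) t) ∧
      ∀ t, |v t| ≤ (M + k ^ 2 * R) / k := by
  have hk0 : 0 < k := hL.trans_lt hk
  let r : (ℝ →ᵇ ℝ) → ℝ → ℝ := fun v t => G t (w t) (v t) - k ^ 2 * w t
  have hr : ∀ v, Continuous (r v) := fun v =>
    (continuous_comp_triple hG continuous_id hw v.continuous).sub (hw.const_mul _)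
  have hB : ∀ v t, |r v t| ≤ M + k ^ 2 * R := fun v t => by
    refine (abs_sub _ _).trans (add_le_add (hM _ _ _) ?_)
    rw [abs_mul, abs_of_nonneg (sq_nonneg k)]
    exact mul_le_mul_of_nonneg_left (hwR t) (sq_nonneg k)
  have hc : ∀ v, Continuous (greenDeriv k (r v)) := fun v =>
    continuous_iff_continuousAt.2 fun t => (hasDerivAt_greenDeriv hk0 (hr v) (hB v) t).continuousAt
  let Φ : (ℝ →ᵇ ℝ) → (ℝ →ᵇ ℝ) := fun v =>
    BoundedContinuousFunction.ofNormedAddCommGroup (greenDeriv k (r v)) (hc v)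
      ((M + k ^ 2 * R) / k) (abs_greenDeriv_le hk0 (hB v))
  have hΦ : ∀ v t, Φ v t = greenDeriv k (r v) t := fun v t => rfl
  have hcontr : ContractingWith (Real.toNNReal (L / k)) Φ := by
    refine ⟨by rw [Real.toNNReal_lt_one]; exact (div_lt_one hk0).2 hk,
      LipschitzWith.of_dist_le' fun v v' => ?_⟩
    rw [dist_le (by positivity)]
    intro t
    rw [hΦ, hΦ, Real.dist_eq, greenDeriv_sub hk0 (hr v) (hr v') (hB v) (hB v')]
    refine (abs_greenDeriv_le (B := L * dist v v') hk0 (fun s => ?_) t).trans_eq (by ring)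
    have h := hlip s (w s) (w s) (v s) (v' s)
    rw [sub_self, abs_zero, zero_add] at h
    have h' : r v s - r v' s = G s (w s) (v s) - G s (w s) (v' s) := by simp only [r]; ring
    rw [h']
    exact h.trans (mul_le_mul_of_nonneg_left (dist_coe_le_dist (f := v) (g := v') s) hL)
  obtain ⟨v, hv⟩ : ∃ v, Φ v = v := ⟨_, hcontr.fixedPoint_isFixedPt⟩
  have hv' : ∀ t, greenDeriv k (r v) t = v t := fun t => by rw [← hΦ, hv]
  have hshift : v.compContinuous ⟨fun t => t + T, by fun_prop⟩ = v := by
    refine hcontr.fixedPoint_unique' (BoundedContinuousFunction.ext fun t => ?_) hv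
    have : r (v.compContinuous ⟨fun t => t + T, by fun_prop⟩) = fun t => r v (t + T) := by
      ext s
      simp only [r, hper, hwp s]
      rfl
    rw [hΦ, this, greenDeriv_comp_add, hv']
    rfl
  have hvp : ∀ t, v (t + T) = v t := fun t => DFunLike.congr_fun hshift t
  have hrp : (fun t => r v (t + T)) = r v := by
    ext t
    simp only [r, hper, hwp t, hvp]
  refine ⟨greenSol k (r v), v, fun t => ?_, fun t => ?_, fun t => ?_, fun t => ?_⟩
  · rw [← greenSol_comp_add, hrp]
  · rw [← hv']
    exact hasDerivAt_greenSol hk0 (hr v) (hB v) t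
  · have h := hasDerivAt_greenDeriv hk0 (hr v) (hB v) t
    rw [show greenDeriv k (r v) = v from funext hv'] at h
    refine h.congr_deriv ?_
    simp only [r]
    ring
  · rw [← hv']
    exact abs_greenDeriv_le hk0 (hB v) t

/-- The method of strict lower and upper solutions for a bounded, globally Lipschitz periodic
second order equation. -/
theorem exists_periodic_between (hT : 0 < T)
    (hG : Continuous fun x : ℝ × ℝ × ℝ => G x.1 x.2.1 x.2.2)
    (hper : ∀ t q v, G (t + T) q v = G t q v) (hM : ∀ t q v, |G t q v| ≤ M) (hL : 0 ≤ L)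
    (hlip : ∀ t q q' v v', |G t q v - G t q' v'| ≤ L * (|q - q'| + |v - v'|))
    {α α' α'' β β' β'' : ℝ → ℝ} {R C : ℝ}
    (hα : ∀ t, HasDerivAt α (α' t) t) (hα' : ∀ t, HasDerivAt α' (α'' t) t)
    (hβ : ∀ t, HasDerivAt β (β' t) t) (hβ' : ∀ t, HasDerivAt β' (β'' t) t)
    (hαp : Function.Periodic α T) (hβp : Function.Periodic β T)
    (hαβ : ∀ t, α t ≤ β t) (hαR : ∀ t, |α t| ≤ R) (hβR : ∀ t, |β t| ≤ R)
    (hαC : ∀ t, |α' t| ≤ C)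
    (hlow : ∀ t, G t (α t) (α' t) < α'' t) (hupp : ∀ t, β'' t < G t (β t) (β' t)) :
    ∃ u v : ℝ → ℝ, Function.Periodic u T ∧ (∀ t, HasDerivAt u (v t) t) ∧
      (∀ t, HasDerivAt v (G t (u t) (v t)) t) ∧ ∀ t, α t < u t ∧ u t < β t := by
  set k := L + 1 with hk
  set K := max C ((M + k ^ 2 * R) / k) with hK
  have hmono : ∀ t q q' v, q ≤ q' → 0 ≤ G t q v - G t q' v + k ^ 2 * (q' - q) := by
    intro t q q' v hq
    have h := (abs_le.1 (hlip t q q' v v)).1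
    rw [sub_self, abs_zero, add_zero, abs_of_nonpos (sub_nonpos.2 hq)] at h
    have : 0 ≤ (k ^ 2 - L) * (q' - q) :=
      mul_nonneg (by rw [hk]; nlinarith) (sub_nonneg.2 hq)
    linarith
  let X : (ℝ → ℝ) → Prop := fun w =>
    (∀ a b, |w a - w b| ≤ K * |a - b|) ∧ Function.Periodic w T ∧ ∀ t, α t ≤ w t ∧ w t ≤ β t
  have hsolve : ∀ w, X w → ∃ u v : ℝ → ℝ, Function.Periodic u T ∧ (∀ t, HasDerivAt u (v t) t) ∧
      (∀ t, HasDerivAt v (G t (w t) (v t) + k ^ 2 * (u t - w t)) t) ∧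
      ∀ t, |v t| ≤ (M + k ^ 2 * R) / k := fun w hw =>
    exists_periodic_frozen hG hper hM hL hlip (by linarith) (continuous_of_abs_sub_le hw.1) hw.2.1
      fun t => abs_le.2 ⟨(abs_le.1 (hαR t)).1.trans (hw.2.2 t).1,
        (hw.2.2 t).2.trans (abs_le.1 (hβR t)).2⟩
  choose! S V hSp hSV hV hVK using hsolve
  have hStrict : ∀ w, X w → ∀ t, α t < S w t ∧ S w t < β t := by
    intro w hw
    obtain ⟨t₀, hmax, hd, hdd⟩ := exists_max_of_periodic hT (hαp.sub (hSp w hw))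
      (fun t => (hα t).sub (hSV w hw t)) (fun t => (hα' t).sub (hV w hw t))
    obtain ⟨t₁, hmax₁, hd₁, hdd₁⟩ := exists_max_of_periodic hT ((hSp w hw).sub hβp)
      (fun t => (hSV w hw t).sub (hβ t)) (fun t => (hV w hw t).sub (hβ' t))
    have e0 : α' t₀ = V w t₀ := sub_eq_zero.1 hd
    have e1 : V w t₁ = β' t₁ := sub_eq_zero.1 hd₁
    have l0 := hlow t₀
    have l1 := hupp t₁
    rw [← e0] at hdd
    rw [e1] at hdd₁
    have m0 := hmono t₀ _ _ (α' t₀) (hw.2.2 t₀).1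
    have m1 := hmono t₁ _ _ (β' t₁) (hw.2.2 t₁).2
    have hk2 : 0 < k ^ 2 := by positivity
    have n0 : α t₀ - S w t₀ < 0 := by
      by_contra! hcon
      nlinarith [mul_nonneg hk2.le hcon]
    have n1 : S w t₁ - β t₁ < 0 := by
      by_contra! hcon
      nlinarith [mul_nonneg hk2.le hcon]
    intro t
    have a0 := hmax t
    have a1 := hmax₁ t
    simp only [Pi.sub_apply] at a0 a1
    constructor <;> linarith
  have hSX : ∀ w, X w → X (S w) := fun w hw =>
    ⟨abs_sub_le_of_hasDerivAt (hSV w hw) fun t => (hVK w hw t).trans (le_max_right _ _),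
      hSp w hw, fun t => ⟨(hStrict w hw t).1.le, (hStrict w hw t).2.le⟩⟩
  have hSmono : ∀ w w', X w → X w' → (∀ t, w t ≤ w' t) → ∀ t, S w t ≤ S w' t := by
    intro w w' hw hw' hle
    obtain ⟨t₀, hmax, hd, hdd⟩ := exists_max_of_periodic hT ((hSp w hw).sub (hSp w' hw'))
      (fun t => (hSV w hw t).sub (hSV w' hw' t)) (fun t => (hV w hw t).sub (hV w' hw' t))
    have e0 : V w t₀ = V w' t₀ := sub_eq_zero.1 hd
    rw [e0] at hdd
    have m0 := hmono t₀ _ _ (V w' t₀) (hle t₀)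
    have hk2 : 0 < k ^ 2 := by positivity
    have n0 : S w t₀ - S w' t₀ ≤ 0 := by
      by_contra! hcon
      nlinarith [mul_pos hk2 hcon]
    intro t
    have a0 := hmax t
    simp only [Pi.sub_apply] at a0
    linarith
  let A : Set (ℝ → ℝ) := {w | X w ∧ ∀ t, w t ≤ S w t}
  have hαX : X α := ⟨abs_sub_le_of_hasDerivAt hα fun t => (hαC t).trans (le_max_left _ _),
    hαp, fun t => ⟨le_rfl, hαβ t⟩⟩
  have hαA : α ∈ A := ⟨hαX, fun t => (hStrict α hαX t).1.le⟩
  have : Nonempty A := ⟨⟨α, hαA⟩⟩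
  let W : ℝ → ℝ := fun t => ⨆ w : A, w.1 t
  have hbdd : ∀ t, BddAbove (range fun w : A => w.1 t) := fun t =>
    ⟨β t, by rintro _ ⟨w, rfl⟩; exact (w.2.1.2.2 t).2⟩
  have hleW : ∀ w ∈ A, ∀ t, w t ≤ W t := fun w hw t => le_ciSup (hbdd t) ⟨w, hw⟩
  have hWle : ∀ t c, (∀ w ∈ A, w t ≤ c) → W t ≤ c := fun t c h => ciSup_le fun w => h w.1 w.2
  have hWlip : ∀ a b, W a - W b ≤ K * |a - b| := fun a b => by
    rw [sub_le_iff_le_add']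
    refine hWle _ _ fun w hw => ?_
    have := (abs_le.1 (hw.1.1 a b)).2
    have := hleW w hw b
    linarith
  have hWX : X W := by
    refine ⟨fun a b => abs_sub_le_iff.2 ⟨hWlip a b, abs_sub_comm a b ▸ hWlip b a⟩, fun t => ?_,
      fun t => ⟨hleW α hαA t, hWle _ _ fun w hw => (hw.1.2.2 t).2⟩⟩
    exact congrArg iSup (funext fun w : A => w.2.1.2.1 t)
  have hWS : ∀ t, W t ≤ S W t := fun t =>
    hWle _ _ fun w hw => (hw.2 t).trans (hSmono w W hw.1 hWX (hleW w hw) t)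
  have hSWA : S W ∈ A := ⟨hSX W hWX, hSmono W (S W) hWX (hSX W hWX) hWS⟩
  have hfix : S W = W := funext fun t => le_antisymm (hleW _ hSWA t) (hWS t)
  refine ⟨S W, V W, hSp W hWX, hSV W hWX, fun t => ?_, hStrict W hWX⟩
  have := hV W hWX t
  rw [hfix] at this ⊢
  simpa using this

end Periodic

/-- A solution of `v' = G t v`, with `G` Lipschitz in `v`, that avoids the equilibrium `c` at one
time avoids it at all times. -/
lemma ne_equilibrium {L : NNReal} {G : ℝ → ℝ → ℝ} (hlip : ∀ t, LipschitzWith L (G t)) {c : ℝ}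
    (hc : ∀ t, G t c = 0) {v : ℝ → ℝ} (hv : ∀ t, HasDerivAt v (G t (v t)) t) {t₁ : ℝ}
    (h : v t₁ ≠ c) (t : ℝ) : v t ≠ c := by
  intro ht
  have := ODE_solution_unique_univ (v := G) (s := fun _ => univ) (K := L) (f := v)
    (g := fun _ => c) (t₀ := t) (fun t => (hlip t).lipschitzOnWith)
    (fun t => ⟨hv t, mem_univ _⟩)
    (fun t => ⟨by simpa [hc] using hasDerivAt_const t c, mem_univ _⟩) ht
  exact h (congrFun this t₁)

lemma exists_abs_le_of_periodic {T : ℝ} (hT : 0 < T) {h : ℝ → ℝ} (hc : Continuous h)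
    (hp : Function.Periodic h T) : ∃ R, ∀ t, |h t| ≤ R := by
  obtain ⟨R, hR⟩ := isCompact_Icc.exists_bound_of_continuousOn (s := Icc 0 T) hc.continuousOn
  refine ⟨R, fun t => ?_⟩
  obtain ⟨y, hy, hty⟩ := hp.exists_mem_Ico₀ hT t
  exact hty ▸ hR y (Ico_subset_Icc_self hy)

/-- The nearest point to `x` in `[-a, a]`. -/
noncomputable def symClamp (a x : ℝ) : ℝ := max (-a) (min a x)

lemma lipschitzWith_symClamp (a : ℝ) : LipschitzWith 1 (symClamp a) :=
  (LipschitzWith.id.const_min a).const_max (-a)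

lemma symClamp_mem {a : ℝ} (ha : 0 ≤ a) (x : ℝ) : symClamp a x ∈ Icc (-a) a :=
  ⟨le_max_left _ _, max_le (by linarith) (min_le_left _ _)⟩

lemma symClamp_eq {a x : ℝ} (h : |x| ≤ a) : symClamp a x = x := by
  rw [symClamp, min_eq_right (abs_le.1 h).2, max_eq_right (abs_le.1 h).1]

lemma abs_symClamp_sub_le (a x y : ℝ) : |symClamp a x - symClamp a y| ≤ |x - y| := by
  simpa [Real.dist_eq] using (lipschitzWith_symClamp a).dist_le_mul x y

/-- The relativistic momentum has derivative `v' / (1 - v ^ 2) ^ (3 / 2)`. -/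
lemma hasDerivAt_momentum {v : ℝ → ℝ} {t F : ℝ} (hlt : |v t| < 1)
    (hv : HasDerivAt v ((1 - v t ^ 2) ^ ((3 : ℝ) / 2) * F) t) :
    HasDerivAt (fun s => v s / Real.sqrt (1 - v s ^ 2)) F t := by
  have hpos : 0 < 1 - v t ^ 2 := by
    have := (sq_lt_one_iff_abs_lt_one (v t)).2 hlt
    linarith
  have hs := Real.sqrt_pos.2 hpos
  have hsq := Real.sq_sqrt hpos.le
  have hrpow : (1 - v t ^ 2) ^ ((3 : ℝ) / 2) = (1 - v t ^ 2) * Real.sqrt (1 - v t ^ 2) := by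
    rw [Real.sqrt_eq_rpow, show (3 : ℝ) / 2 = 1 + 1 / 2 by norm_num, Real.rpow_add hpos,
      Real.rpow_one]
  rw [hrpow] at hv
  have h1 : HasDerivAt (fun s => Real.sqrt (1 - v s ^ 2)) _ t :=
    ((hv.pow 2).const_sub 1).sqrt hpos.ne'
  refine (hv.div h1 hs.ne').congr_deriv ?_
  simp only [Pi.pow_apply]
  generalize Real.sqrt (1 - v t ^ 2) = s at *
  rw [← hsq]
  field_simp
  linear_combination 2 * F * hsq

/-- Sufficient conditions for a `T`-periodic solution of the
forced relativistic equation `d/dt (q̇ / √(1 - q̇²)) = f(t, q, q̇)`: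
if `h₁ < h₂` are `C²` barrier functions (`T`-periodic, with `|ḣᵢ| < 1`) satisfying
`(1 - ḣ₁²)^{3/2} f(t,h₁,ḣ₁) - ḧ₁ < 0` and `(1 - ḣ₂²)^{3/2} f(t,h₂,ḣ₂) - ḧ₂ > 0`,
then there is a `T`-periodic solution `q` with `h₁ < q < h₂`. -/
theorem stmt_0 (T : ℝ) (hT : 0 < T) (f : ℝ → ℝ → ℝ → ℝ)
    (hf : ContDiff ℝ 1 (fun x : ℝ × ℝ × ℝ => f x.1 x.2.1 x.2.2))
    (hf_per : ∀ t q p, f (t + T) q p = f t q p)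
    (h₁ h₂ : ℝ → ℝ) (hh₁ : ContDiff ℝ 2 h₁) (hh₂ : ContDiff ℝ 2 h₂)
    (hh₁_per : ∀ t, h₁ (t + T) = h₁ t) (hh₂_per : ∀ t, h₂ (t + T) = h₂ t)
    (h_lt : ∀ t, h₁ t < h₂ t)
    (hd₁ : ∀ t, |deriv h₁ t| < 1) (hd₂ : ∀ t, |deriv h₂ t| < 1)
    (hc₁ : ∀ t, (1 - (deriv h₁ t) ^ 2) ^ ((3 : ℝ) / 2) * f t (h₁ t) (deriv h₁ t)
      - deriv (deriv h₁) t < 0)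
    (hc₂ : ∀ t, (1 - (deriv h₂ t) ^ 2) ^ ((3 : ℝ) / 2) * f t (h₂ t) (deriv h₂ t)
      - deriv (deriv h₂) t > 0) :
    ∃ q : ℝ → ℝ, ContDiff ℝ 2 q ∧ (∀ t, q (t + T) = q t) ∧ (∀ t, |deriv q t| < 1) ∧
      (∀ t, HasDerivAt (fun s => deriv q s / Real.sqrt (1 - (deriv q s) ^ 2))
        (f t (q t) (deriv q t)) t) ∧
      (∀ t, h₁ t < q t ∧ q t < h₂ t) := by
  obtain ⟨R₁, hR₁⟩ := exists_abs_le_of_periodic hT hh₁.continuous hh₁_per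
  obtain ⟨R₂, hR₂⟩ := exists_abs_le_of_periodic hT hh₂.continuous hh₂_per
  set R := max R₁ R₂ with hR
  have hR₁' : ∀ t, |h₁ t| ≤ R := fun t => (hR₁ t).trans (le_max_left _ _)
  have hR₂' : ∀ t, |h₂ t| ≤ R := fun t => (hR₂ t).trans (le_max_right _ _)
  have hR0 : 0 ≤ R := (abs_nonneg _).trans (hR₁' 0)
  let g : ℝ → ℝ → ℝ → ℝ := fun t q v => (1 - v ^ 2) ^ ((3 : ℝ) / 2) * f t q v
  have hg : ContDiff ℝ 1 (fun x : ℝ × ℝ × ℝ => g x.1 x.2.1 x.2.2) := by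
    have h32 : ContDiff ℝ 1 fun x : ℝ => x ^ ((3 : ℝ) / 2) := by
      exact_mod_cast Real.contDiff_rpow_const_of_le (n := 1) (by norm_num)
    have hinner : ContDiff ℝ 1 fun x : ℝ × ℝ × ℝ => 1 - x.2.2 ^ 2 := by fun_prop
    have hfac : ContDiff ℝ 1 fun x : ℝ × ℝ × ℝ => (1 - x.2.2 ^ 2) ^ ((3 : ℝ) / 2) :=
      h32.comp hinner
    exact hfac.mul hf
  have hgp : Function.Periodic g T := fun t => by
    ext q v
    simp only [g, hf_per]
  let s : Set (ℝ × ℝ × ℝ) := Icc 0 T ×ˢ (Icc (-R) R ×ˢ Icc (-1) 1)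
  have hs : IsCompact s := isCompact_Icc.prod (isCompact_Icc.prod isCompact_Icc)
  have hsc : Convex ℝ s := (convex_Icc _ _).prod ((convex_Icc _ _).prod (convex_Icc _ _))
  obtain ⟨L, hL⟩ := hg.contDiffOn.exists_lipschitzOnWith one_ne_zero hsc hs
  obtain ⟨M, hM⟩ := hs.exists_bound_of_continuousOn hg.continuous.continuousOn
  let G : ℝ → ℝ → ℝ → ℝ := fun t q v => g t (symClamp R q) (symClamp 1 v)
  have hGcont : Continuous fun x : ℝ × ℝ × ℝ => G x.1 x.2.1 x.2.2 :=
    continuous_comp_triple hg.continuous continuous_fst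
      ((lipschitzWith_symClamp R).continuous.comp (by fun_prop))
      ((lipschitzWith_symClamp 1).continuous.comp (by fun_prop))
  have hmem : ∀ t ∈ Ico 0 T, ∀ q v, (t, symClamp R q, symClamp 1 v) ∈ s := fun t ht q v =>
    ⟨Ico_subset_Icc_self ht, symClamp_mem hR0 q, symClamp_mem zero_le_one v⟩
  have hGM : ∀ t q v, |G t q v| ≤ M := fun t q v => by
    obtain ⟨y, hy, hty⟩ := hgp.exists_mem_Ico₀ hT t
    simp only [G, hty]
    have h := hM _ (hmem y hy q v)
    rwa [Real.norm_eq_abs] at h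
  have hGlip : ∀ t q q' v v', |G t q v - G t q' v'| ≤ L * (|q - q'| + |v - v'|) := by
    intro t q q' v v'
    obtain ⟨y, hy, hty⟩ := hgp.exists_mem_Ico₀ hT t
    simp only [G, hty]
    have h := hL.dist_le_mul _ (hmem y hy q v) _ (hmem y hy q' v')
    simp only [Prod.dist_eq, Real.dist_eq, sub_self, abs_zero] at h
    refine h.trans (mul_le_mul_of_nonneg_left ?_ L.2)
    have hq := abs_symClamp_sub_le R q q'
    have hv := abs_symClamp_sub_le 1 v v'
    have hq0 := abs_nonneg (q - q')
    have hv0 := abs_nonneg (v - v')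
    refine max_le (by linarith) (max_le (by linarith) (by linarith))
  have hGeq : ∀ t q v, |q| ≤ R → |v| ≤ 1 → G t q v = g t q v := fun t q v hq hv => by
    simp only [G, symClamp_eq hq, symClamp_eq hv]
  have hderiv : ∀ h : ℝ → ℝ, ContDiff ℝ 2 h →
      (∀ t, HasDerivAt h (deriv h t) t) ∧ ∀ t, HasDerivAt (deriv h) (deriv (deriv h) t) t := by
    intro h hh
    have h2 := (contDiff_succ_iff_deriv (n := 1)).1 (by simpa [one_add_one_eq_two] using hh)
    exact ⟨fun t => (h2.1 t).hasDerivAt,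
      fun t => ((contDiff_one_iff_deriv.1 h2.2.2).1 t).hasDerivAt⟩
  obtain ⟨u, v, hup, huv, hv, hbetween⟩ := exists_periodic_between hT hGcont
    (fun t q v => by simp only [G, hgp t]) hGM L.2 hGlip
    (hderiv h₁ hh₁).1 (hderiv h₁ hh₁).2 (hderiv h₂ hh₂).1 (hderiv h₂ hh₂).2 hh₁_per hh₂_per
    (fun t => (h_lt t).le) hR₁' hR₂' (fun t => (hd₁ t).le)
    (fun t => by rw [hGeq t _ _ (hR₁' t) (hd₁ t).le]; exact sub_neg.1 (hc₁ t))
    (fun t => by rw [hGeq t _ _ (hR₂' t) (hd₂ t).le]; exact sub_pos.1 (hc₂ t))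
  have huR : ∀ t, |u t| ≤ R := fun t => abs_le.2
    ⟨(abs_le.1 (hR₁' t)).1.trans (hbetween t).1.le, (hbetween t).2.le.trans (abs_le.1 (hR₂' t)).2⟩
  have hvc : Continuous v := continuous_iff_continuousAt.2 fun t => (hv t).continuousAt
  have huc : Continuous u := continuous_iff_continuousAt.2 fun t => (huv t).continuousAt
  obtain ⟨t₁, -, ht₁, -⟩ := exists_max_of_periodic hT hup huv hv
  have hlipv : ∀ t, LipschitzWith L (G t (u t)) := fun t =>
    LipschitzWith.of_dist_le_mul fun x y => by
      simpa [Real.dist_eq] using hGlip t (u t) (u t) x y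
  have hG1 : ∀ c : ℝ, |c| = 1 → ∀ t, G t (u t) c = 0 := fun c hc t => by
    rw [hGeq t _ _ (huR t) hc.le]
    simp only [g]
    rw [← sq_abs, hc, one_pow, sub_self, Real.zero_rpow (by norm_num), zero_mul]
  have hne : ∀ c : ℝ, |c| = 1 → ∀ t, v t ≠ c := fun c hc =>
    ne_equilibrium hlipv (hG1 c hc) hv (t₁ := t₁) (by rw [ht₁]; rintro rfl; simp at hc)
  have hv1 : ∀ t, |v t| < 1 := by
    intro t
    by_contra! hcon
    obtain ⟨x, hx⟩ := intermediate_value_univ t₁ t hvc.abs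
      (show (1 : ℝ) ∈ Icc |v t₁| |v t| from ⟨by rw [ht₁]; simp, hcon⟩)
    exact hne (v x) hx x rfl
  have hdu : deriv u = v := funext fun t => (huv t).deriv
  have hdv : deriv v = fun t => G t (u t) (v t) := funext fun t => (hv t).deriv
  refine ⟨u, ?_, hup, fun t => hdu ▸ hv1 t, fun t => ?_, hbetween⟩
  · rw [← one_add_one_eq_two, contDiff_succ_iff_deriv, hdu, contDiff_one_iff_deriv, hdv]
    exact ⟨fun t => (huv t).differentiableAt, by simp, fun t => (hv t).differentiableAt,
      continuous_comp_triple hGcont continuous_id huc hvc⟩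
  · rw [hdu]
    refine hasDerivAt_momentum (hv1 t) ((hv t).congr_deriv ?_)
    rw [hGeq t _ _ (huR t) (hv1 t).le]
end

section
/- Let T > 0, α > 0, and let f : (ℝ/Tℤ) × (ℝ/2πℤ) × ℝ → ℝ be C¹ and satisfy f(t, −π/2, 0) < α and f(t, π/2, 0) > −α for all t ∈ [0, T]. Then the forced relativistic pendulum equation d/dt ( φ̇ / √(1 − φ̇²) ) = f(t, φ, φ̇) + α sin φ has at least one T-periodic solution φ, and this solution satisfies −π/2 < φ(t) < π/2 for all t (the pendulum never reaches the horizontal position). -/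
open Set Filter Topology
open scoped NNReal

/-- A continuous function on a preconnected set that avoids the endpoints of an interval and takes
one value in it takes all its values in it. -/
theorem IsPreconnected.mapsTo_Ioo_of_forall_ne {X : Type*} [TopologicalSpace X] {S : Set X}
    (hS : IsPreconnected S) {θ : X → ℝ} (hθ : ContinuousOn θ S) {c d : ℝ} {x₀ : X} (hx₀ : x₀ ∈ S)
    (h₀ : θ x₀ ∈ Ioo c d) (hne : ∀ x ∈ S, θ x ≠ c ∧ θ x ≠ d) : MapsTo θ S (Ioo c d) := by
  intro x hx
  have hoc := (hS.image θ hθ).ordConnected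
  by_contra hcon
  rw [mem_Ioo, not_and_or, not_lt, not_lt] at hcon
  rcases hcon with h | h
  · obtain ⟨y, hy, hyc⟩ := hoc.out (mem_image_of_mem θ hx) (mem_image_of_mem θ hx₀) ⟨h, h₀.1.le⟩
    exact (hne y hy).1 hyc
  · obtain ⟨y, hy, hyc⟩ := hoc.out (mem_image_of_mem θ hx₀) (mem_image_of_mem θ hx) ⟨h₀.2.le, h⟩
    exact (hne y hy).2 hyc

/-- The planar **Poincaré–Miranda theorem** with strict sign conditions on the sides. -/
theorem exists_eq_zero_of_forall_sides {a b : ℝ} (ha : 0 < a) (hb : 0 < b) {u v : ℝ × ℝ → ℝ}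
    (hu : ContinuousOn u (Icc (-a) a ×ˢ Icc (-b) b))
    (hv : ContinuousOn v (Icc (-a) a ×ˢ Icc (-b) b))
    (hright : ∀ y ∈ Icc (-b) b, 0 < u (a, y)) (hleft : ∀ y ∈ Icc (-b) b, u (-a, y) < 0)
    (htop : ∀ x ∈ Icc (-a) a, 0 < v (x, b)) (hbot : ∀ x ∈ Icc (-a) a, v (x, -b) < 0) :
    ∃ z ∈ Icc (-a) a ×ˢ Icc (-b) b, u z = 0 ∧ v z = 0 := by
  by_contra! hcon
  have haa : -a ≤ a := by linarith
  have hbb : -b ≤ b := by linarith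
  have ha_mem : a ∈ Icc (-a) a := right_mem_Icc.2 haa
  have hb_mem : b ∈ Icc (-b) b := right_mem_Icc.2 hbb
  have ha_mem' : -a ∈ Icc (-a) a := left_mem_Icc.2 haa
  have hb_mem' : -b ∈ Icc (-b) b := left_mem_Icc.2 hbb
  let π : ℝ × ℝ → ℝ × ℝ := fun z => (projIcc (-a) a haa z.1, projIcc (-b) b hbb z.2)
  have hπ : Continuous π := by
    refine Continuous.prodMk ?_ ?_
    · exact continuous_subtype_val.comp (continuous_projIcc.comp continuous_fst)
    · exact continuous_subtype_val.comp (continuous_projIcc.comp continuous_snd)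
  have hπ_mem : ∀ z, π z ∈ Icc (-a) a ×ˢ Icc (-b) b := fun z => ⟨Subtype.prop _, Subtype.prop _⟩
  have hπ_eq : ∀ x ∈ Icc (-a) a, ∀ y ∈ Icc (-b) b, π (x, y) = (x, y) := by
    intro x hx y hy
    simp only [π, projIcc_of_mem haa hx, projIcc_of_mem hbb hy]
  let F : ℝ × ℝ → ℂ := fun z => ⟨u (π z), v (π z)⟩
  have hF : Continuous F := by
    have h1 : Continuous fun z => u (π z) := hu.comp_continuous hπ hπ_mem
    have h2 : Continuous fun z => v (π z) := hv.comp_continuous hπ hπ_mem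
    exact Complex.equivRealProdCLM.symm.continuous.comp (h1.prodMk h2)
  have hF0 : ∀ z, F z ≠ 0 := fun z hz => by
    have := Complex.ext_iff.1 hz
    exact hcon _ (hπ_mem z) this.1 this.2
  obtain ⟨L, ⟨hL0, hL⟩, -⟩ := Complex.isCoveringMapOn_exp.existsUnique_continuousMap_lifts
    ⟨F, hF⟩ (a₀ := (a, b)) (Complex.exp_log (hF0 (a, b))) (fun z => hF0 z)
  let θ : ℝ × ℝ → ℝ := fun z => (L z).im
  have hθ : Continuous θ := Complex.continuous_im.comp L.continuous
  have hexp : ∀ x ∈ Icc (-a) a, ∀ y ∈ Icc (-b) b, ∃ ρ > 0,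
      u (x, y) = ρ * Real.cos (θ (x, y)) ∧ v (x, y) = ρ * Real.sin (θ (x, y)) := by
    intro x hx y hy
    have h : Complex.exp (L (x, y)) = F (x, y) := congrFun hL (x, y)
    refine ⟨Real.exp (L (x, y)).re, Real.exp_pos _, ?_, ?_⟩
    · have := congrArg Complex.re h
      rw [Complex.exp_re] at this
      simpa only [F, hπ_eq x hx y hy] using this.symm
    · have := congrArg Complex.im h
      rw [Complex.exp_im] at this
      simpa only [F, hπ_eq x hx y hy] using this.symm
  have hcos_right : ∀ y ∈ Icc (-b) b, 0 < Real.cos (θ (a, y)) := fun y hy => by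
    obtain ⟨ρ, hρ, h, -⟩ := hexp a ha_mem y hy
    exact (mul_pos_iff_of_pos_left hρ).1 (h ▸ hright y hy)
  have hcos_left : ∀ y ∈ Icc (-b) b, Real.cos (θ (-a, y)) < 0 := fun y hy => by
    obtain ⟨ρ, hρ, h, -⟩ := hexp (-a) ha_mem' y hy
    have := hleft y hy
    by_contra! h'
    nlinarith [mul_nonneg hρ.le h']
  have hsin_top : ∀ x ∈ Icc (-a) a, 0 < Real.sin (θ (x, b)) := fun x hx => by
    obtain ⟨ρ, hρ, -, h⟩ := hexp x hx b hb_mem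
    exact (mul_pos_iff_of_pos_left hρ).1 (h ▸ htop x hx)
  have hsin_bot : ∀ x ∈ Icc (-a) a, Real.sin (θ (x, -b)) < 0 := fun x hx => by
    obtain ⟨ρ, hρ, -, h⟩ := hexp x hx (-b) hb_mem'
    have := hbot x hx
    by_contra! h'
    nlinarith [mul_nonneg hρ.le h']
  have hvert : ∀ x, ContinuousOn (fun y => θ (x, y)) (Icc (-b) b) := fun x => by fun_prop
  have hhor : ∀ y, ContinuousOn (fun x => θ (x, y)) (Icc (-a) a) := fun y => by fun_prop
  have hpi := Real.pi_pos
  have hcorner : θ (a, b) ∈ Ioo (-(Real.pi / 2)) (Real.pi / 2) := by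
    have hre : 0 < (F (a, b)).re := by
      simp only [F, hπ_eq a ha_mem b hb_mem]; exact hright b hb_mem
    have h : θ (a, b) = (F (a, b)).arg := by
      simp only [θ, hL0, Complex.log_im, ContinuousMap.coe_mk]
    rw [h]
    have := Complex.abs_arg_lt_pi_div_two_iff.2 (Or.inl hre)
    exact abs_lt.1 this
  have hR : MapsTo (fun y => θ (a, y)) (Icc (-b) b) (Ioo (-(Real.pi / 2)) (Real.pi / 2)) := by
    refine isPreconnected_Icc.mapsTo_Ioo_of_forall_ne (hvert a) hb_mem hcorner fun y hy => ?_
    have := hcos_right y hy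
    constructor <;> intro h <;> rw [h] at this <;> simp at this
  have hT : MapsTo (fun x => θ (x, b)) (Icc (-a) a) (Ioo 0 Real.pi) := by
    refine isPreconnected_Icc.mapsTo_Ioo_of_forall_ne (hhor b) ha_mem ?_ fun x hx => ?_
    · have h := hsin_top a ha_mem
      refine ⟨?_, by linarith [hcorner.2]⟩
      by_contra! h'
      linarith [Real.sin_nonpos_of_nonpos_of_neg_pi_le h' (by linarith [hcorner.1])]
    · have := hsin_top x hx
      constructor <;> intro h <;> rw [h] at this <;> simp at this
  have h32 : Real.cos (3 * Real.pi / 2) = 0 := by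
    rw [show 3 * Real.pi / 2 = Real.pi / 2 + Real.pi by ring, Real.cos_add_pi]; simp
  have hL' : MapsTo (fun y => θ (-a, y)) (Icc (-b) b) (Ioo (Real.pi / 2) (3 * Real.pi / 2)) := by
    refine isPreconnected_Icc.mapsTo_Ioo_of_forall_ne (hvert (-a)) hb_mem ?_ fun y hy => ?_
    · have h := hcos_left b hb_mem
      have h1 := hT ha_mem'
      refine ⟨?_, by linarith [h1.2]⟩
      by_contra! h'
      linarith [Real.cos_nonneg_of_neg_pi_div_two_le_of_le (by linarith [h1.1]) h']
    · have := hcos_left y hy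
      constructor <;> intro h <;> rw [h] at this <;> simp [h32] at this
  have hB : MapsTo (fun x => θ (x, -b)) (Icc (-a) a) (Ioo Real.pi (2 * Real.pi)) := by
    refine isPreconnected_Icc.mapsTo_Ioo_of_forall_ne (hhor (-b)) ha_mem' ?_ fun x hx => ?_
    · have h := hsin_bot (-a) ha_mem'
      have h1 := hL' hb_mem'
      refine ⟨?_, by linarith [h1.2]⟩
      by_contra! h'
      linarith [Real.sin_nonneg_of_nonneg_of_le_pi (by linarith [h1.1]) h']
    · have := hsin_bot x hx
      constructor <;> intro h <;> rw [h] at this <;> simp at this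
  linarith [(hR hb_mem').2, (hB ha_mem).1]

/-- An integral curve on `[0, T]` of a `T`-periodic vector field with equal endpoints extends to a
`T`-periodic integral curve on the whole line. -/
theorem exists_periodic_hasDerivAt {E : Type*} [NormedAddCommGroup E] [NormedSpace ℝ E]
    [CompleteSpace E] {T : ℝ} (hT : 0 < T) {G : ℝ → E → E}
    (hG : Continuous fun x : ℝ × E => G x.1 x.2) (hper : ∀ t z, G (t + T) z = G t z) {γ : ℝ → E}
    (hγ : γ 0 = γ T)
    (hderiv : ∀ t ∈ Icc 0 T, HasDerivWithinAt γ (G t (γ t)) (Icc 0 T) t) :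
    ∃ Z : ℝ → E, (∀ t, Z (t + T) = Z t) ∧ ∀ t, HasDerivAt Z (G t (Z t)) t := by
  have : Fact (0 < T) := ⟨hT⟩
  have hγc : ContinuousOn γ (Icc 0 T) := fun t ht => (hderiv t ht).continuousWithinAt
  let Z : ℝ → E := fun t => AddCircle.liftIco T 0 γ (t : AddCircle T)
  have hZc : Continuous Z :=
    (AddCircle.liftIco_zero_continuous hγ hγc).comp (AddCircle.continuous_mk' T)
  have hZper : ∀ t, Z (t + T) = Z t := fun t => by simp [Z]
  have hZγ : EqOn Z γ (Icc 0 T) := by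
    intro t ht
    rcases ht.2.eq_or_lt with rfl | h
    · have h0 : Z 0 = γ 0 := AddCircle.liftIco_zero_coe_apply ⟨le_rfl, hT⟩
      rw [← hγ, ← h0, ← hZper 0, zero_add]
    · exact AddCircle.liftIco_zero_coe_apply ⟨ht.1, h⟩
  have hFc : Continuous fun s => G s (Z s) := hG.comp (continuous_id.prodMk hZc)
  have hFper : Function.Periodic (fun s => G s (Z s)) T := fun s => by simp [hZper, hper]
  let W : ℝ → E := fun t => γ 0 + ∫ s in (0 : ℝ)..t, G s (Z s)
  have hWγ : EqOn W γ (Icc 0 T) := by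
    intro t ht
    have : ∫ s in (0 : ℝ)..t, G s (Z s) = γ t - γ 0 := by
      refine intervalIntegral.integral_eq_sub_of_hasDerivAt_of_le ht.1
        (hγc.mono (Icc_subset_Icc_right ht.2)) (fun s hs => ?_) (hFc.intervalIntegrable _ _)
      have hs' : s ∈ Icc 0 T := ⟨hs.1.le, hs.2.le.trans ht.2⟩
      rw [hZγ hs']
      exact (hderiv s hs').hasDerivAt (Icc_mem_nhds hs.1 (hs.2.trans_le ht.2))
    simp [W, this]
  have hint : ∀ a b, IntervalIntegrable (fun s => G s (Z s)) MeasureTheory.volume a b :=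
    fun a b => hFc.intervalIntegrable a b
  have hWper : ∀ t, W (t + T) = W t := by
    intro t
    have h1 : ∫ s in t..t + T, G s (Z s) = 0 := by
      rw [hFper.intervalIntegral_add_eq t 0, zero_add]
      have h2 : W T = γ T := hWγ ⟨hT.le, le_rfl⟩
      simpa [W, hγ] using h2
    have h3 := intervalIntegral.integral_add_adjacent_intervals (hint 0 t) (hint t (t + T))
    simp [W, ← h3, h1]
  have hWZ : W = Z := by
    funext t
    have hp : Function.Periodic (fun s => W s - Z s) T := fun s => by simp [hWper, hZper]
    obtain ⟨y, hy, h⟩ := hp.exists_mem_Ico₀ hT t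
    have hy' : y ∈ Icc 0 T := Ico_subset_Icc_self hy
    rw [hWγ hy', hZγ hy', sub_self] at h
    exact sub_eq_zero.1 h
  refine ⟨Z, hZper, fun t => ?_⟩
  have : HasDerivAt W (G t (Z t)) t :=
    (intervalIntegral.integral_hasDerivAt_right (hint 0 t)
      (hFc.stronglyMeasurableAtFilter _ _) hFc.continuousAt).const_add _
  rwa [hWZ] at this

/-- A function on `[0, T]` whose derivative is bounded by `C` stays within `C * T` of its initial
value. -/
theorem abs_sub_le_of_hasDerivWithinAt {T C : ℝ} {x x' : ℝ → ℝ}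
    (hx : ∀ t ∈ Icc 0 T, HasDerivWithinAt x (x' t) (Icc 0 T) t)
    (hC : ∀ t ∈ Icc 0 T, |x' t| ≤ C) {t : ℝ} (ht : t ∈ Icc 0 T) : |x t - x 0| ≤ C * T := by
  have hT : 0 ≤ T := ht.1.trans ht.2
  have h := norm_image_sub_le_of_norm_deriv_le_segment' hx (fun s hs => hC s ⟨hs.1, hs.2.le⟩) t ht
  have hC0 : 0 ≤ C := (abs_nonneg _).trans (hC t ht)
  rw [Real.norm_eq_abs] at h
  nlinarith [mul_le_mul_of_nonneg_left ht.2 hC0]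

theorem lt_of_hasDerivWithinAt_pos {T : ℝ} (hT : 0 < T) {x x' : ℝ → ℝ}
    (hx : ∀ t ∈ Icc 0 T, HasDerivWithinAt x (x' t) (Icc 0 T) t)
    (hpos : ∀ t ∈ Icc 0 T, 0 < x' t) : x 0 < x T := by
  refine strictMonoOn_of_hasDerivWithinAt_pos (f' := x') (convex_Icc 0 T)
    (fun t ht => (hx t ht).continuousWithinAt) (fun t ht => ?_) (fun t ht => ?_)
    (left_mem_Icc.2 hT.le) (right_mem_Icc.2 hT.le) hT
  · exact (hx t (interior_subset ht)).mono interior_subset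
  · exact hpos t (interior_subset ht)

/-- Existence of an orbit on `[0, T]` with equal endpoints for the planar system
`x' = v y`, `y' = h t (x, y)`, where `v` has the sign of `y` and `h` the sign of `x` for large
`|x|`. -/
theorem exists_orbit_eq_endpoints {T R : ℝ} {M Kv Kh : ℝ≥0} (hT : 0 < T) (hR : 0 < R)
    {v : ℝ → ℝ} {h : ℝ → ℝ × ℝ → ℝ} (hv : LipschitzWith Kv v) (hv1 : ∀ y, |v y| ≤ 1)
    (hvpos : ∀ y, 0 < y → 0 < v y) (hvodd : ∀ y, v (-y) = -v y)
    (hh : ∀ t ∈ Icc 0 T, LipschitzWith Kh (h t))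
    (hc : ∀ z, Continuous fun t => h t z)
    (hM : ∀ t ∈ Icc 0 T, ∀ z, |h t z| ≤ M)
    (hpos : ∀ t ∈ Icc 0 T, ∀ z : ℝ × ℝ, R ≤ z.1 → 0 < h t z)
    (hneg : ∀ t ∈ Icc 0 T, ∀ z : ℝ × ℝ, z.1 ≤ -R → h t z < 0) :
    ∃ γ : ℝ → ℝ × ℝ, γ 0 = γ T ∧
      ∀ t ∈ Icc 0 T, HasDerivWithinAt γ (v (γ t).2, h t (γ t)) (Icc 0 T) t := by
  lift T to ℝ≥0 using hT.le
  lift R to ℝ≥0 using hR.le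
  have hT0 : (0 : ℝ) ∈ Icc (0 : ℝ) T := ⟨le_rfl, hT.le⟩
  have hTT : (T : ℝ) ∈ Icc (0 : ℝ) T := ⟨hT.le, le_rfl⟩
  let a : ℝ≥0 := R + T
  let b : ℝ≥0 := M * T + 1
  have ha : (0 : ℝ) < a := by simp only [a, NNReal.coe_add]; positivity
  have hb : (0 : ℝ) < b := by simp only [b, NNReal.coe_add, NNReal.coe_mul]; positivity
  have hPL : IsPicardLindelof (fun t (z : ℝ × ℝ) => (v z.2, h t z)) (⟨0, hT0⟩ : Icc (0 : ℝ) T)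
      (0 : ℝ × ℝ) (max a b + max 1 M * T) (max a b) (max 1 M) (max Kv Kh) := by
    refine ⟨fun t ht => ?_, fun z _ => ?_, fun t ht z _ => ?_, ?_⟩
    · have := (hv.comp LipschitzWith.prod_snd).prodMk (hh t ht)
      rw [mul_one] at this
      exact this.lipschitzOnWith
    · exact (continuous_const.prodMk (hc z)).continuousOn
    · rw [Prod.norm_def, NNReal.coe_max]
      exact max_le_max (hv1 _) (hM t ht z)
    · simp [hT.le]
  obtain ⟨Φ, hΦ, L, hΦL⟩ :=
    hPL.exists_forall_mem_closedBall_eq_hasDerivWithinAt_lipschitzOnWith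
  have hsub : Icc (-(a : ℝ)) a ×ˢ Icc (-(b : ℝ)) b ⊆
      Metric.closedBall (0 : ℝ × ℝ) ((max a b : ℝ≥0) : ℝ) := by
    intro z hz
    rw [mem_closedBall_zero_iff, Prod.norm_def, NNReal.coe_max]
    exact max_le_max (abs_le.2 hz.1) (abs_le.2 hz.2)
  have hcont : ContinuousOn (fun z => Φ z T) (Icc (-(a : ℝ)) a ×ˢ Icc (-(b : ℝ)) b) :=
    (hΦL T hTT).continuousOn.mono hsub
  have hΦ1 : ∀ z ∈ Icc (-(a : ℝ)) a ×ˢ Icc (-(b : ℝ)) b, ∀ t ∈ Icc (0 : ℝ) T,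
      HasDerivWithinAt (fun t => (Φ z t).1) (v (Φ z t).2) (Icc (0 : ℝ) T) t :=
    fun z hz t ht => ((hΦ z (hsub hz)).2 t ht).fst
  have hΦ2 : ∀ z ∈ Icc (-(a : ℝ)) a ×ˢ Icc (-(b : ℝ)) b, ∀ t ∈ Icc (0 : ℝ) T,
      HasDerivWithinAt (fun t => (Φ z t).2) (h t (Φ z t)) (Icc (0 : ℝ) T) t :=
    fun z hz t ht => ((hΦ z (hsub hz)).2 t ht).snd
  have hΦ0 : ∀ z ∈ Icc (-(a : ℝ)) a ×ˢ Icc (-(b : ℝ)) b, Φ z 0 = z :=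
    fun z hz => (hΦ z (hsub hz)).1
  have hx : ∀ z ∈ Icc (-(a : ℝ)) a ×ˢ Icc (-(b : ℝ)) b, ∀ t ∈ Icc (0 : ℝ) T,
      |(Φ z t).1 - z.1| ≤ T := fun z hz t ht => by
    have := abs_sub_le_of_hasDerivWithinAt (hΦ1 z hz) (fun s _ => hv1 _) ht
    rwa [hΦ0 z hz, one_mul] at this
  have hy : ∀ z ∈ Icc (-(a : ℝ)) a ×ˢ Icc (-(b : ℝ)) b, ∀ t ∈ Icc (0 : ℝ) T,
      |(Φ z t).2 - z.2| ≤ M * T := fun z hz t ht => by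
    have := abs_sub_le_of_hasDerivWithinAt (hΦ2 z hz) (fun s hs => hM s hs _) ht
    rwa [hΦ0 z hz] at this
  have haR : (a : ℝ) = R + T := by simp [a]
  have hbM : (b : ℝ) = M * T + 1 := by simp [b]
  obtain ⟨z, hz, h2, h1⟩ := exists_eq_zero_of_forall_sides ha hb
    (u := fun z => (Φ z T).2 - z.2) (v := fun z => (Φ z T).1 - z.1)
    (by fun_prop) (by fun_prop)
    (fun y hy' => by
      have hz : ((a : ℝ), y) ∈ Icc (-(a : ℝ)) a ×ˢ Icc (-(b : ℝ)) b :=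
        ⟨right_mem_Icc.2 (by linarith), hy'⟩
      have := lt_of_hasDerivWithinAt_pos hT (hΦ2 _ hz) fun t ht =>
        hpos t ht _ (by linarith [(abs_le.1 (hx _ hz t ht)).1])
      rw [hΦ0 _ hz] at this
      exact sub_pos.2 this)
    (fun y hy' => by
      have hz : (-(a : ℝ), y) ∈ Icc (-(a : ℝ)) a ×ˢ Icc (-(b : ℝ)) b :=
        ⟨left_mem_Icc.2 (by linarith), hy'⟩
      have := lt_of_hasDerivWithinAt_pos hT (fun t ht => (hΦ2 _ hz t ht).neg) fun t ht =>
        neg_pos.2 (hneg t ht _ (by linarith [(abs_le.1 (hx _ hz t ht)).2]))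
      simp only [Pi.neg_apply, hΦ0 _ hz] at this
      exact sub_neg.2 (neg_lt_neg_iff.1 this))
    (fun x hx' => by
      have hz : (x, (b : ℝ)) ∈ Icc (-(a : ℝ)) a ×ˢ Icc (-(b : ℝ)) b :=
        ⟨hx', right_mem_Icc.2 (by linarith)⟩
      have := lt_of_hasDerivWithinAt_pos hT (hΦ1 _ hz) fun t ht =>
        hvpos _ (by linarith [(abs_le.1 (hy _ hz t ht)).1])
      rw [hΦ0 _ hz] at this
      exact sub_pos.2 this)
    (fun x hx' => by
      have hz : (x, -(b : ℝ)) ∈ Icc (-(a : ℝ)) a ×ˢ Icc (-(b : ℝ)) b :=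
        ⟨hx', left_mem_Icc.2 (by linarith)⟩
      have := lt_of_hasDerivWithinAt_pos hT (fun t ht => (hΦ1 _ hz t ht).neg) fun t ht => by
        rw [← hvodd]
        exact hvpos _ (by linarith [(abs_le.1 (hy _ hz t ht)).2])
      simp only [Pi.neg_apply, hΦ0 _ hz] at this
      exact sub_neg.2 (neg_lt_neg_iff.1 this))
  refine ⟨Φ z, ?_, (hΦ z (hsub hz)).2⟩
  rw [hΦ0 z hz]
  exact Prod.ext (sub_eq_zero.1 h1).symm (sub_eq_zero.1 h2).symm

/-- A periodic solution of `φ' = v p`, `p' = w` stays below `s` if `w` is positive whenever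
`p = 0` and `s ≤ φ`. -/
theorem lt_of_forall_deriv_pos_of_periodic {T s : ℝ} (hT : 0 < T) {φ p v w : ℝ → ℝ}
    (hper : ∀ t, φ (t + T) = φ t) (hφ : ∀ t, HasDerivAt φ (v (p t)) t)
    (hp : ∀ t, HasDerivAt p (w t) t) (hvpos : ∀ y, 0 < y → 0 < v y)
    (hv0 : ∀ y, v y = 0 → y = 0) (hw : ∀ t, s ≤ φ t → p t = 0 → 0 < w t) (t : ℝ) : φ t < s := by
  have hφc : Continuous φ := continuous_iff_continuousAt.2 fun t => (hφ t).continuousAt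
  obtain ⟨t₀, -, hmax'⟩ := isCompact_Icc.exists_isMaxOn (nonempty_Icc.2 hT.le) hφc.continuousOn
  have hmax : ∀ t, φ t ≤ φ t₀ := fun t => by
    obtain ⟨y, hy, h⟩ := Function.Periodic.exists_mem_Ico₀ hper hT t
    rw [h]
    exact hmax' (Ico_subset_Icc_self hy)
  refine (hmax t).trans_lt ?_
  by_contra! hs
  have hp0 : p t₀ = 0 :=
    hv0 _ (IsLocalMax.hasDerivAt_eq_zero (Eventually.of_forall hmax) (hφ t₀))
  have hev : ∀ᶠ r in 𝓝[>] t₀, 0 < p r := by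
    have h1 := (hasDerivAt_iff_tendsto_slope.1 (hp t₀)).eventually (lt_mem_nhds (hw t₀ hs hp0))
    filter_upwards [h1.filter_mono (nhdsWithin_mono _ fun r (hr : t₀ < r) => hr.ne'),
      self_mem_nhdsWithin] with r hr hr'
    rw [slope_def_field, hp0, sub_zero] at hr
    exact (div_pos_iff_of_pos_right (sub_pos.2 hr')).1 hr
  obtain ⟨r, hr, hsub⟩ := mem_nhdsGT_iff_exists_Ioo_subset.1 hev
  have hlt : φ t₀ < φ r := by
    refine strictMonoOn_of_deriv_pos (convex_Icc t₀ r) hφc.continuousOn (fun x hx => ?_)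
      (left_mem_Icc.2 hr.le) (right_mem_Icc.2 hr.le) hr
    rw [interior_Icc] at hx
    rw [(hφ x).deriv]
    exact hvpos _ (hsub hx)
  exact hlt.not_ge (hmax r)

theorem lipschitzWith_max_min (s : ℝ) : LipschitzWith 1 fun x : ℝ => max (-s) (min s x) :=
  (LipschitzWith.id.const_min s).const_max (-s)

theorem Real.lipschitzWith_sin_arctan : LipschitzWith 1 fun y : ℝ => Real.sin (Real.arctan y) := by
  have h : LipschitzWith 1 Real.arctan := by
    refine lipschitzWith_of_nnnorm_deriv_le Real.differentiable_arctan fun x => ?_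
    rw [← NNReal.coe_le_coe, coe_nnnorm, Real.deriv_arctan, Real.norm_eq_abs,
      abs_of_pos (by positivity), NNReal.coe_one]
    exact div_le_one_of_le₀ (by nlinarith [sq_nonneg x]) (by positivity)
  have h' := Real.lipschitzWith_sin.comp h
  rwa [one_mul] at h'

theorem Real.sin_arctan_div_sqrt (y : ℝ) :
    Real.sin (Real.arctan y) / √(1 - Real.sin (Real.arctan y) ^ 2) = y := by
  rw [← Real.cos_sq', Real.sqrt_sq (Real.cos_arctan_pos y).le, ← Real.tan_eq_sin_div_cos,
    Real.tan_arctan]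

theorem Real.abs_sin_arctan_lt_one (y : ℝ) : |Real.sin (Real.arctan y)| < 1 := by
  rw [← sq_lt_one_iff_abs_lt_one]
  nlinarith [Real.sin_sq_add_cos_sq (Real.arctan y), pow_pos (Real.cos_arctan_pos y) 2]

/-- The planar system `φ' = sin (arctan p)`, `p' = g (t, φ, sin (arctan p))` has a `T`-periodic
solution with `|φ| < s` if `g` points outwards on the lines `φ = ± s` at zero velocity. -/
theorem exists_periodic_solution_of_pointing_outwards {T s : ℝ} (hT : 0 < T) (hs : 0 < s)
    {g : ℝ × ℝ × ℝ → ℝ} (hg : ContDiff ℝ 1 g) (hper : ∀ t x y, g (t + T, x, y) = g (t, x, y))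
    (hlow : ∀ t, g (t, -s, 0) < 0) (hhigh : ∀ t, 0 < g (t, s, 0)) :
    ∃ φ p : ℝ → ℝ, (∀ t, φ (t + T) = φ t) ∧
      (∀ t, HasDerivAt φ (Real.sin (Real.arctan (p t))) t) ∧
      (∀ t, HasDerivAt p (g (t, φ t, Real.sin (Real.arctan (p t)))) t) ∧
      ∀ t, -s < φ t ∧ φ t < s := by
  let c : ℝ → ℝ → ℝ := fun s x => max (-s) (min s x)
  let v : ℝ → ℝ := fun y => Real.sin (Real.arctan y)
  have hc : ∀ s, LipschitzWith 1 (c s) := lipschitzWith_max_min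
  have hc_mem : ∀ s, 0 ≤ s → ∀ x, c s x ∈ Icc (-s) s := fun s hs x =>
    ⟨le_max_left _ _, max_le (by linarith) (min_le_left _ _)⟩
  have hc_ge : ∀ s x, 0 ≤ s → s ≤ x → c s x = s := fun s x hs hx => by
    simp only [c, min_eq_left hx]; exact max_eq_right (by linarith)
  have hc_le : ∀ s x, 0 ≤ s → x ≤ -s → c s x = -s := fun s x hs hx => by
    simp only [c]; exact max_eq_left (min_le_of_right_le hx)
  have hc_eq : ∀ s x, -s ≤ x → x ≤ s → c s x = x := fun s x h1 h2 => by
    simp only [c, min_eq_right h2, max_eq_right h1]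
  have hv : LipschitzWith 1 v := Real.lipschitzWith_sin_arctan
  have hv1 : ∀ y, |v y| ≤ 1 := fun y => (Real.abs_sin_arctan_lt_one y).le
  have hvodd : ∀ y, v (-y) = -v y := fun y => by simp [v, Real.arctan_neg]
  have hv00 : v 0 = 0 := by simp [v]
  have hv_mem : ∀ y, v y ∈ Icc (-1 : ℝ) 1 := fun y => abs_le.1 (hv1 y)
  obtain ⟨M₀, hM₀⟩ := (isCompact_Icc.prod (isCompact_Icc.prod isCompact_Icc) :
    IsCompact (Icc 0 T ×ˢ Icc (-s) s ×ˢ Icc (-1 : ℝ) 1)).exists_bound_of_continuousOn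
      hg.continuous.continuousOn
  have hM₀0 : 0 ≤ M₀ := (norm_nonneg _).trans
    (hM₀ (0, 0, 0) ⟨⟨le_rfl, hT.le⟩, ⟨by simp [hs.le], hs.le⟩, by simp⟩)
  let H : ℝ × ℝ × ℝ × ℝ → ℝ := fun x =>
    g (x.1, x.2.1, x.2.2.2) + (M₀ + 1) * (x.2.2.1 - x.2.1)
  have hH : ContDiff ℝ 1 H := by fun_prop
  let S : Set (ℝ × ℝ × ℝ × ℝ) :=
    Icc 0 T ×ˢ Icc (-s) s ×ˢ Icc (-(s + 1)) (s + 1) ×ˢ Icc (-1 : ℝ) 1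
  have hS : IsCompact S :=
    isCompact_Icc.prod (isCompact_Icc.prod (isCompact_Icc.prod isCompact_Icc))
  have hSconv : Convex ℝ S :=
    (convex_Icc _ _).prod ((convex_Icc _ _).prod ((convex_Icc _ _).prod (convex_Icc _ _)))
  obtain ⟨K, hK⟩ := hH.contDiffOn.exists_lipschitzOnWith one_ne_zero hSconv hS
  obtain ⟨M, hM⟩ := hS.exists_bound_of_continuousOn hH.continuous.continuousOn
  let h : ℝ → ℝ × ℝ → ℝ := fun t z => H (t, c s z.1, c (s + 1) z.1, v z.2)
  have hmemS : ∀ t ∈ Icc 0 T, ∀ z : ℝ × ℝ, (t, c s z.1, c (s + 1) z.1, v z.2) ∈ S :=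
    fun t ht z => ⟨ht, hc_mem s hs.le _, hc_mem _ (by linarith) _, hv_mem _⟩
  have hg_le : ∀ t ∈ Icc 0 T, ∀ z : ℝ × ℝ, |g (t, c s z.1, v z.2)| ≤ M₀ :=
    fun t ht z => hM₀ _ ⟨ht, hc_mem s hs.le _, hv_mem _⟩
  obtain ⟨Kh, hKh⟩ : ∃ Kh, ∀ t ∈ Icc 0 T, LipschitzWith Kh (h t) := by
    have hfst : LipschitzWith 1 (Prod.fst : ℝ × ℝ → ℝ) := LipschitzWith.prod_fst
    have hsnd : LipschitzWith 1 (Prod.snd : ℝ × ℝ → ℝ) := LipschitzWith.prod_snd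
    have hmap := fun t : ℝ => (LipschitzWith.const (α := ℝ × ℝ) t).prodMk
      (((hc s).comp hfst).prodMk (((hc (s + 1)).comp hfst).prodMk (hv.comp hsnd)))
    exact ⟨_, fun t ht => lipschitzOnWith_univ.1
      (hK.comp ((hmap t).lipschitzOnWith (s := univ)) fun z _ => hmemS t ht z)⟩
  have hcont : Continuous fun x : ℝ × ℝ × ℝ => h x.1 x.2 := by
    have h1 := (hc s).continuous
    have h2 := (hc (s + 1)).continuous
    have h3 := hv.continuous
    have h4 := hH.continuous
    fun_prop
  obtain ⟨γ, hγ, hγ'⟩ := exists_orbit_eq_endpoints (R := s + 1) (M := M.toNNReal) hT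
    (by linarith) hv hv1 (fun y hy => Real.sin_arctan_pos.2 hy) hvodd hKh
    (fun z => by exact hcont.comp (continuous_id.prodMk continuous_const))
    (fun t ht z => (hM _ (hmemS t ht z)).trans (Real.le_coe_toNNReal M))
    (fun t ht z hz => by
      have h1 := (abs_le.1 (hg_le t ht z)).1
      have h2 : h t z = g (t, c s z.1, v z.2) + (M₀ + 1) * (c (s + 1) z.1 - c s z.1) := rfl
      rw [h2, hc_ge (s + 1) _ (by linarith) hz]
      nlinarith [hc_ge s z.1 hs.le (by linarith)])
    (fun t ht z hz => by
      have h1 := (abs_le.1 (hg_le t ht z)).2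
      have h2 : h t z = g (t, c s z.1, v z.2) + (M₀ + 1) * (c (s + 1) z.1 - c s z.1) := rfl
      rw [h2, hc_le (s + 1) _ (by linarith) hz]
      nlinarith [hc_le s z.1 hs.le (by linarith)])
  have hper' : ∀ t z, h (t + T) z = h t z := fun t z => by simp [h, H, hper]
  obtain ⟨Z, hZper, hZ⟩ := exists_periodic_hasDerivAt (G := fun t z => (v z.2, h t z)) hT
    ((hv.continuous.comp (continuous_snd.comp continuous_snd)).prodMk hcont)
    (fun t z => by simp [hper']) hγ hγ'
  have hφ : ∀ t, HasDerivAt (fun t => (Z t).1) (v (Z t).2) t := fun t => (hZ t).fst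
  have hp : ∀ t, HasDerivAt (fun t => (Z t).2) (h t (Z t)) t := fun t => (hZ t).snd
  have hlt : ∀ t, (Z t).1 < s := by
    refine lt_of_forall_deriv_pos_of_periodic hT (fun t => by rw [hZper]) hφ hp
      (fun y => Real.sin_arctan_pos.2) (fun y => Real.sin_arctan_eq_zero.1) fun t h1 h2 => ?_
    have h3 : h t (Z t) = g (t, s, 0) + (M₀ + 1) * (c (s + 1) (Z t).1 - s) := by
      simp only [h, H, hc_ge s _ hs.le h1, h2, hv00]
    have h4 : s ≤ c (s + 1) (Z t).1 := le_max_of_le_right (le_min (by linarith) h1)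
    have := mul_nonneg (by linarith : 0 ≤ M₀ + 1) (sub_nonneg.2 h4)
    linarith [hhigh t]
  have hgt : ∀ t, -(Z t).1 < s := by
    refine lt_of_forall_deriv_pos_of_periodic (φ := fun t => -(Z t).1) (p := fun t => -(Z t).2)
      (v := v) (w := fun t => -h t (Z t)) hT (fun t => by rw [hZper])
      (fun t => by rw [hvodd]; exact (hφ t).neg) (fun t => (hp t).neg)
      (fun y => Real.sin_arctan_pos.2) (fun y => Real.sin_arctan_eq_zero.1) fun t h1 h2 => ?_
    have h3 : h t (Z t) = g (t, -s, 0) + (M₀ + 1) * (c (s + 1) (Z t).1 + s) := by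
      simp only [h, H, hc_le s (Z t).1 hs.le (by linarith), neg_eq_zero.1 h2, hv00, sub_neg_eq_add]
    have h4 : c (s + 1) (Z t).1 ≤ -s := max_le (by linarith) (min_le_of_right_le (by linarith))
    have := mul_nonneg (by linarith : 0 ≤ M₀ + 1) (by linarith : 0 ≤ -s - c (s + 1) (Z t).1)
    linarith [hlow t]
  refine ⟨fun t => (Z t).1, fun t => (Z t).2, fun t => congrArg Prod.fst (hZper t), hφ, fun t => ?_,
    fun t => ⟨by linarith [hgt t], hlt t⟩⟩
  have h1 := hgt t
  have h2 := hlt t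
  have h3 : h t (Z t) = g (t, (Z t).1, v (Z t).2) := by
    simp only [h, H, hc_eq s _ (by linarith) h2.le, hc_eq (s + 1) (Z t).1 (by linarith)
      (by linarith), sub_self, mul_zero, add_zero]
  exact h3 ▸ hp t


/-- The forced relativistic pendulum
`d/dt (φ̇ / √(1 - φ̇²)) = f(t, φ, φ̇) + α sin φ`, with `f` `T`-periodic in `t` and
`2π`-periodic in `φ`, satisfying `f(t, -π/2, 0) < α` and `f(t, π/2, 0) > -α` on `[0,T]`,
has a `T`-periodic solution `φ` with `-π/2 < φ(t) < π/2` for all `t`. -/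
theorem stmt_1 (T α : ℝ) (hT : 0 < T) (hα : 0 < α) (f : ℝ → ℝ → ℝ → ℝ)
    (hf : ContDiff ℝ 1 (fun x : ℝ × ℝ × ℝ => f x.1 x.2.1 x.2.2))
    (hf_per_t : ∀ t φ p, f (t + T) φ p = f t φ p)
    (hf_per_φ : ∀ t φ p, f t (φ + 2 * Real.pi) p = f t φ p)
    (hlow : ∀ t ∈ Set.Icc (0 : ℝ) T, f t (-(Real.pi / 2)) 0 < α)
    (hhigh : ∀ t ∈ Set.Icc (0 : ℝ) T, f t (Real.pi / 2) 0 > -α) :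
    ∃ φ : ℝ → ℝ, ContDiff ℝ 2 φ ∧ (∀ t, φ (t + T) = φ t) ∧ (∀ t, |deriv φ t| < 1) ∧
      (∀ t, HasDerivAt (fun s => deriv φ s / Real.sqrt (1 - (deriv φ s) ^ 2))
        (f t (φ t) (deriv φ t) + α * Real.sin (φ t)) t) ∧
      (∀ t, -(Real.pi / 2) < φ t ∧ φ t < Real.pi / 2) := by
  have hpi := Real.pi_pos
  have hred : ∀ t φ p, ∃ r ∈ Set.Icc 0 T, f t φ p = f r φ p := fun t φ p => by
    obtain ⟨r, hr, h⟩ :=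
      Function.Periodic.exists_mem_Ico₀ (f := fun t => f t φ p) (fun t => hf_per_t t φ p) hT t
    exact ⟨r, Ico_subset_Icc_self hr, h⟩
  obtain ⟨φ, p, hφper, hφ, hp, hbound⟩ := exists_periodic_solution_of_pointing_outwards
    (s := Real.pi / 2) (g := fun x => f x.1 x.2.1 x.2.2 + α * Real.sin x.2.1) hT (by positivity)
    (hf.add (contDiff_const.mul (Real.contDiff_sin.comp (contDiff_fst.comp contDiff_snd))))
    (fun t x y => by simp only [hf_per_t])
    (fun t => by
      obtain ⟨r, hr, h⟩ := hred t (-(Real.pi / 2)) 0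
      simp only [h, Real.sin_neg, Real.sin_pi_div_two]
      linarith [hlow r hr])
    (fun t => by
      obtain ⟨r, hr, h⟩ := hred t (Real.pi / 2) 0
      simp only [h, Real.sin_pi_div_two]
      linarith [hhigh r hr])
  have hdφ : deriv φ = fun t => Real.sin (Real.arctan (p t)) := funext fun t => (hφ t).deriv
  have hφc : Continuous φ := continuous_iff_continuousAt.2 fun t => (hφ t).continuousAt
  have hpc : Continuous p := continuous_iff_continuousAt.2 fun t => (hp t).continuousAt
  have hp1 : ContDiff ℝ 1 p := by
    refine contDiff_one_iff_deriv.2 ⟨fun t => (hp t).differentiableAt, ?_⟩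
    rw [funext fun t => (hp t).deriv]
    exact (hf.continuous.comp (continuous_id.prodMk (hφc.prodMk
      (Real.continuous_sin.comp (Real.continuous_arctan.comp hpc))))).add
        (continuous_const.mul (Real.continuous_sin.comp hφc))
  refine ⟨φ, ?_, hφper, fun t => ?_, fun t => ?_, hbound⟩
  · rw [show (2 : WithTop ℕ∞) = 1 + 1 by norm_num, contDiff_succ_iff_deriv]
    refine ⟨fun t => (hφ t).differentiableAt, by simp, ?_⟩
    rw [hdφ]
    exact Real.contDiff_sin.comp (Real.contDiff_arctan.comp hp1)
  · rw [hdφ]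
    exact Real.abs_sin_arctan_lt_one _
  · simp only [hdφ, Real.sin_arctan_div_sqrt]
    exact hp t
end

section
/- Let T > 0, α > 0, γ ∈ ℝ, let y : ℝ → ℝ be C² and let f : (ℝ/Tℤ) × ℝ × ℝ → ℝ be C¹. Suppose there exist q₁ < q₂ with y′(q₁) = 1, y′(q₂) = −1, and suppose f(t, q₁, 0) < α and f(t, q₂, 0) > −α for all t ∈ [0, T]. Then the equation d/dt ( q̇ / √(1 − q̇²) ) = f(t, q, q̇) − γ q̇ − α y′(q), describing a forced relativistic particle with friction moving in a gravitational field on a planar curve with natural parameter q and height function y, has at least one T-periodic solution q with q₁ < q(t) < q₂ for all t ∈ ℝ. -/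
section

open Set Filter Topology

/-- A continuous real function that avoids `l` and `u` on an interval and takes one value
in `(l, u)` there takes all its values in `(l, u)`. -/
lemma mem_Ioo_of_forall_ne {h : ℝ → ℝ} (hc : Continuous h) {s : Set ℝ} [hs : s.OrdConnected]
    {l u x y : ℝ} (hx : x ∈ s) (hy : y ∈ s) (hxu : h x ∈ Ioo l u)
    (hl : ∀ z ∈ s, h z ≠ l) (hu : ∀ z ∈ s, h z ≠ u) : h y ∈ Ioo l u := by
  have key := intermediate_value_uIcc (hc.continuousOn (s := uIcc x y))
  have hsub : uIcc x y ⊆ s := hs.uIcc_subset hx hy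
  refine ⟨?_, ?_⟩
  · by_contra! hcon
    obtain ⟨z, hz, hzl⟩ := key (mem_uIcc.2 (Or.inr ⟨hcon, hxu.1.le⟩))
    exact hl z (hsub hz) hzl
  · by_contra! hcon
    obtain ⟨z, hz, hzl⟩ := key (mem_uIcc.2 (Or.inl ⟨hxu.2.le, hcon⟩))
    exact hu z (hsub hz) hzl

/-- A continuous nowhere vanishing planar vector field on the plane has a continuous
logarithm with prescribed imaginary part at a point. -/
lemma exists_continuous_log (F : C(ℝ × ℝ, ℂ)) (hF : ∀ x, F x ≠ 0) (x₀ : ℝ × ℝ) :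
    ∃ G : C(ℝ × ℝ, ℂ), (G x₀).im = (F x₀).arg ∧ ∀ x, Complex.exp (G x) = F x := by
  obtain ⟨G, ⟨hG₀, hG⟩, -⟩ := Complex.isCoveringMapOn_exp.existsUnique_continuousMap_lifts F
    (Complex.exp_log (hF x₀)) (fun x => by simpa using hF x)
  exact ⟨G, by rw [hG₀, Complex.log_im], fun x => congrFun hG x⟩

/-- A planar **Poincaré–Miranda theorem**, for functions defined on the whole plane. -/
theorem exists_zero_of_signs_on_rectangle {f g : ℝ × ℝ → ℝ} (hf : Continuous f)
    (hg : Continuous g) {a b c d : ℝ} (hab : a ≤ b) (hcd : c ≤ d)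
    (hfa : ∀ y ∈ Icc c d, f (a, y) < 0) (hfb : ∀ y ∈ Icc c d, 0 < f (b, y))
    (hgc : ∀ x ∈ Icc a b, g (x, c) < 0) (hgd : ∀ x ∈ Icc a b, 0 < g (x, d)) :
    ∃ z, f z = 0 ∧ g z = 0 := by
  by_contra! hne
  let F : C(ℝ × ℝ, ℂ) := ⟨fun z => ⟨f z, g z⟩, by
    have : (fun z => (⟨f z, g z⟩ : ℂ)) = fun z => (f z : ℂ) + g z * Complex.I := by
      funext z; exact Complex.mk_eq_add_mul_I _ _
    rw [this]; fun_prop⟩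
  have hF : ∀ z, F z ≠ 0 := fun z hz =>
    hne z (congrArg Complex.re hz) (congrArg Complex.im hz)
  obtain ⟨G, hG₀, hG⟩ := exists_continuous_log F hF (b, d)
  set θ : ℝ × ℝ → ℝ := fun z => (G z).im with hθ
  have hθc : Continuous θ := by fun_prop
  have hfc : ∀ z, f z = Real.exp (G z).re * Real.cos (θ z) := fun z => by
    rw [← Complex.exp_re, hG]; rfl
  have hgs : ∀ z, g z = Real.exp (G z).re * Real.sin (θ z) := fun z => by
    rw [← Complex.exp_im, hG]; rfl
  have hfcos : ∀ z, Real.cos (θ z) = 0 → f z = 0 := fun z h => by rw [hfc, h, mul_zero]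
  have hgsin : ∀ z, Real.sin (θ z) = 0 → g z = 0 := fun z h => by rw [hgs, h, mul_zero]
  have hπ := Real.pi_pos
  have hsinπ : Real.sin (2 * Real.pi) = 0 := Real.sin_two_pi
  have hcos3 : Real.cos (3 * Real.pi / 2) = 0 := by
    rw [show 3 * Real.pi / 2 = Real.pi / 2 + Real.pi by ring, Real.cos_add_pi]; simp
  have ha : a ∈ Icc a b := ⟨le_rfl, hab⟩
  have hb : b ∈ Icc a b := ⟨hab, le_rfl⟩
  have hc : c ∈ Icc c d := ⟨le_rfl, hcd⟩
  have hd : d ∈ Icc c d := ⟨hcd, le_rfl⟩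
  have hbd : θ (b, d) ∈ Ioo 0 (Real.pi / 2) := by
    have hre : 0 < (F (b, d)).re := hfb d hd
    have him : 0 < (F (b, d)).im := hgd b hb
    have h1 : (F (b, d)).arg < Real.pi / 2 :=
      (abs_lt.1 (Complex.abs_arg_lt_pi_div_two_iff.2 (Or.inl hre))).2
    have h2 : 0 ≤ (F (b, d)).arg := Complex.arg_nonneg_iff.2 him.le
    have h3 : (F (b, d)).arg ≠ 0 := fun h => by
      rw [Complex.arg_eq_zero_iff] at h; exact him.ne' h.2
    rw [← hG₀] at h1 h2 h3
    exact ⟨lt_of_le_of_ne h2 h3.symm, h1⟩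
  have had : θ (a, d) ∈ Ioo 0 Real.pi :=
    mem_Ioo_of_forall_ne (h := fun x => θ (x, d)) (by fun_prop) hb ha
      ⟨hbd.1, by linarith [hbd.2]⟩
      (fun x hx h => (hgd x hx).ne' (hgsin _ (by rw [h, Real.sin_zero])))
      (fun x hx h => (hgd x hx).ne' (hgsin _ (by rw [h, Real.sin_pi])))
  have had' : Real.pi / 2 < θ (a, d) := by
    by_contra! h
    have := Real.cos_nonneg_of_neg_pi_div_two_le_of_le (by linarith [had.1]) h
    have h2 := hfa d hd
    rw [hfc] at h2
    exact absurd h2 (not_lt.2 (by positivity))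
  have hac : θ (a, c) ∈ Ioo (Real.pi / 2) (3 * Real.pi / 2) :=
    mem_Ioo_of_forall_ne (h := fun y => θ (a, y)) (by fun_prop) hd hc
      ⟨had', by linarith [had.2]⟩
      (fun y hy h => (hfa y hy).ne (hfcos _ (by rw [h, Real.cos_pi_div_two])))
      (fun y hy h => (hfa y hy).ne (hfcos _ (by rw [h, hcos3])))
  have hac' : Real.pi < θ (a, c) := by
    by_contra! h
    have := Real.sin_nonneg_of_nonneg_of_le_pi (by linarith [hac.1]) h
    have h2 := hgc a ha
    rw [hgs] at h2
    exact absurd h2 (not_lt.2 (by positivity))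
  have hbc : θ (b, c) ∈ Ioo Real.pi (2 * Real.pi) :=
    mem_Ioo_of_forall_ne (h := fun x => θ (x, c)) (by fun_prop) ha hb
      ⟨hac', by linarith [hac.2]⟩
      (fun x hx h => (hgc x hx).ne (hgsin _ (by rw [h, Real.sin_pi])))
      (fun x hx h => (hgc x hx).ne (hgsin _ (by rw [h, hsinπ])))
  have hbc' : θ (b, c) ∈ Ioo (-(Real.pi / 2)) (Real.pi / 2) :=
    mem_Ioo_of_forall_ne (h := fun y => θ (b, y)) (by fun_prop) hd hc
      ⟨by linarith [hbd.1], hbd.2⟩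
      (fun y hy h => (hfb y hy).ne' (hfcos _ (by rw [h, Real.cos_neg, Real.cos_pi_div_two])))
      (fun y hy h => (hfb y hy).ne' (hfcos _ (by rw [h, Real.cos_pi_div_two])))
  linarith [hbc.1, hbc'.2]

/-- A bounded time-dependent vector field that is uniformly Lipschitz on `[0, T]` has a solution
on `[0, T]` for every initial value, and the final value depends continuously on it. -/
theorem exists_continuous_flow {E : Type*} [NormedAddCommGroup E] [NormedSpace ℝ E]
    [CompleteSpace E] {V : ℝ → E → E} {T : ℝ} (hT : 0 ≤ T) {K L : NNReal}
    (hV : Continuous fun z : ℝ × E => V z.1 z.2)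
    (hK : ∀ t ∈ Icc 0 T, LipschitzWith K (V t)) (hL : ∀ t ∈ Icc 0 T, ∀ x, ‖V t x‖ ≤ L) :
    ∃ Φ : E → ℝ → E, (∀ x, Φ x 0 = x) ∧
      (∀ x, ∀ t ∈ Icc 0 T, HasDerivWithinAt (Φ x) (V t (Φ x t)) (Icc 0 T) t) ∧
      Continuous fun x => Φ x T := by
  have hsol : ∀ x, ∃ u : ℝ → E, u 0 = x ∧
      ∀ t ∈ Icc 0 T, HasDerivWithinAt u (V t (u t)) (Icc 0 T) t := fun x => by
    have hP : IsPicardLindelof V (⟨0, le_rfl, hT⟩ : Icc 0 T) x (L * T.toNNReal) 0 L K :=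
      { lipschitzOnWith := fun t ht => (hK t ht).lipschitzOnWith
        continuousOn := fun x _ => by
          have : Continuous fun t => V t x := hV.comp (by fun_prop : Continuous fun t => (t, x))
          exact this.continuousOn
        norm_le := fun t ht x _ => hL t ht x
        mul_max_le := by simp [hT] }
    simpa using hP.exists_eq_forall_mem_Icc_hasDerivWithinAt₀
  choose Φ hΦ0 hΦ using hsol
  refine ⟨Φ, hΦ0, hΦ, ?_⟩
  have hIci : ∀ x, ∀ t ∈ Ico 0 T, HasDerivWithinAt (Φ x) (V t (Φ x t)) (Ici t) t :=
    fun x t ht => (hΦ x t ⟨ht.1, ht.2.le⟩).mono_of_mem_nhdsWithin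
      (Icc_mem_nhdsGE_of_mem ht)
  have hcont : ∀ x, ContinuousOn (Φ x) (Icc 0 T) := fun x t ht => (hΦ x t ht).continuousWithinAt
  refine (LipschitzWith.of_dist_le_mul (K := ⟨Real.exp (K * T), (Real.exp_pos _).le⟩)
    fun x x' => ?_).continuous
  have := dist_le_of_trajectories_ODE_of_mem (s := fun _ => univ)
    (fun t ht => (hK t ⟨ht.1, ht.2.le⟩).lipschitzOnWith) (hcont x) (hIci x)
    (fun _ _ => mem_univ _) (hcont x') (hIci x') (fun _ _ => mem_univ _)
    (by rw [hΦ0, hΦ0] : dist (Φ x 0) (Φ x' 0) ≤ dist x x') T ⟨hT, le_rfl⟩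
  rw [sub_zero, mul_comm] at this
  exact this

/-- A solution on `[0, T]` of a `T`-periodic differential equation with equal values at the
endpoints extends to a `T`-periodic solution on `ℝ`. -/
theorem exists_periodic_extension {E : Type*} [NormedAddCommGroup E] [NormedSpace ℝ E]
    [CompleteSpace E] {V : ℝ → E → E} {T : ℝ} (hT : 0 < T)
    (hV : Continuous fun z : ℝ × E => V z.1 z.2) (hper : ∀ t x, V (t + T) x = V t x)
    {u : ℝ → E} (hu : ∀ t ∈ Icc 0 T, HasDerivWithinAt u (V t (u t)) (Icc 0 T) t)
    (huT : u 0 = u T) :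
    ∃ U : ℝ → E, (∀ t, U (t + T) = U t) ∧ ∀ t, HasDerivAt U (V t (U t)) t := by
  have : Fact (0 < T) := ⟨hT⟩
  have hucont : ContinuousOn u (Icc 0 T) := fun t ht => (hu t ht).continuousWithinAt
  let U : ℝ → E := fun t => AddCircle.liftIco T 0 u (t : AddCircle T)
  have hUcont : Continuous U :=
    (AddCircle.liftIco_zero_continuous huT hucont).comp (AddCircle.continuous_mk' T)
  have hUper : ∀ t, U (t + T) = U t := fun t => by simp [U]
  have hUu : ∀ t ∈ Icc 0 T, U t = u t := fun t ht => by
    rcases ht.2.lt_or_eq with h | rfl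
    · exact AddCircle.liftIco_zero_coe_apply ⟨ht.1, h⟩
    · have h0 := hUper 0
      rw [zero_add] at h0
      rw [h0, ← huT]
      exact AddCircle.liftIco_zero_coe_apply ⟨le_rfl, hT⟩
  let v : ℝ → E := fun t => V t (U t)
  have hvcont : Continuous v := hV.comp (continuous_id.prodMk hUcont)
  have hvper : Function.Periodic v T := fun t => by simp only [v]; rw [hUper, hper]
  let W : ℝ → E := fun t => u 0 + ∫ s in (0 : ℝ)..t, v s
  have hW : ∀ t, HasDerivAt W (v t) t := fun t =>
    (hvcont.integral_hasStrictDerivAt 0 t).hasDerivAt.const_add _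
  have hWu : ∀ t ∈ Icc 0 T, W t = u t := fun t ht => by
    have hint : ∫ s in (0 : ℝ)..t, v s = u t - u 0 :=
      intervalIntegral.integral_eq_sub_of_hasDerivAt_of_le ht.1
        (hucont.mono (Icc_subset_Icc_right ht.2))
        (fun s hs => by
          have hs' : s ∈ Ioo 0 T := ⟨hs.1, hs.2.trans_le ht.2⟩
          have := (hu s (Ioo_subset_Icc_self hs')).hasDerivAt (Icc_mem_nhds hs'.1 hs'.2)
          simpa only [v, hUu s (Ioo_subset_Icc_self hs')] using this)
        (hvcont.intervalIntegrable _ _)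
    simp only [W, hint]; abel
  have hWper : Function.Periodic W T := fun t => by
    have h0 : ∫ s in (0 : ℝ)..T, v s = 0 := by
      have := hWu T ⟨hT.le, le_rfl⟩
      rw [← huT] at this
      simpa [W] using this
    have h1 := hvper.intervalIntegral_add_eq t 0
    rw [zero_add, h0] at h1
    simp only [W]
    rw [← intervalIntegral.integral_add_adjacent_intervals
      (hvcont.intervalIntegrable 0 t) (hvcont.intervalIntegrable t (t + T)), h1, add_zero]
  have hWU : ∀ t, W t = U t := fun t => by
    have hper' : Function.Periodic (fun t => W t - U t) T := fun t => by
      simp only [hWper t, hUper t]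
    obtain ⟨s, hs, hts⟩ := hper'.exists_mem_Ico₀ hT t
    have hs' := Ico_subset_Icc_self hs
    exact sub_eq_zero.1 (hts.trans (sub_eq_zero.2 ((hWu s hs').trans (hUu s hs').symm)))
  exact ⟨W, hWper, fun t => by simpa only [v, hWU] using hW t⟩

/-- The velocity of a relativistic particle of unit mass as a function of its momentum. -/
noncomputable def relVelocity (p : ℝ) : ℝ := p / Real.sqrt (1 + p ^ 2)

lemma relVelocity_eq_sin_arctan (p : ℝ) : relVelocity p = Real.sin (Real.arctan p) :=
  (Real.sin_arctan p).symm

lemma sqrt_one_add_sq_pos (p : ℝ) : 0 < Real.sqrt (1 + p ^ 2) := Real.sqrt_pos.2 (by positivity)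

lemma relVelocity_pos {p : ℝ} (hp : 0 < p) : 0 < relVelocity p :=
  div_pos hp (sqrt_one_add_sq_pos p)

lemma relVelocity_neg (p : ℝ) : relVelocity (-p) = -relVelocity p := by
  simp [relVelocity, neg_div]

lemma relVelocity_eq_zero {p : ℝ} : relVelocity p = 0 ↔ p = 0 := by
  simp [relVelocity, (sqrt_one_add_sq_pos p).ne']

lemma relVelocity_sq (p : ℝ) : relVelocity p ^ 2 = p ^ 2 / (1 + p ^ 2) := by
  rw [relVelocity, div_pow, Real.sq_sqrt (by positivity)]

lemma abs_relVelocity_lt_one (p : ℝ) : |relVelocity p| < 1 := by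
  rw [← sq_lt_one_iff_abs_lt_one, relVelocity_sq, div_lt_one (by positivity)]
  linarith

lemma relVelocity_div_sqrt (p : ℝ) :
    relVelocity p / Real.sqrt (1 - relVelocity p ^ 2) = p := by
  have h : 1 - relVelocity p ^ 2 = 1 / (1 + p ^ 2) := by
    rw [relVelocity_sq]
    have : 1 + p ^ 2 ≠ 0 := by positivity
    field_simp
    ring
  have := (sqrt_one_add_sq_pos p).ne'
  rw [h, Real.sqrt_div zero_le_one, Real.sqrt_one, relVelocity]
  field_simp

lemma contDiff_relVelocity {n : WithTop ℕ∞} : ContDiff ℝ n relVelocity := by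
  rw [funext relVelocity_eq_sin_arctan]
  exact Real.contDiff_sin.comp Real.contDiff_arctan

lemma lipschitzWith_relVelocity : LipschitzWith 1 relVelocity := by
  have harctan : LipschitzWith 1 Real.arctan := by
    refine lipschitzWith_of_nnnorm_deriv_le Real.differentiable_arctan fun x => ?_
    rw [← NNReal.coe_le_coe, coe_nnnorm, Real.deriv_arctan, Real.norm_eq_abs,
      abs_of_pos (by positivity), NNReal.coe_one, div_le_one (by positivity)]
    nlinarith [sq_nonneg x]
  rw [funext relVelocity_eq_sin_arctan, ← one_mul (1 : NNReal)]
  exact Real.lipschitzWith_sin.comp harctan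

lemma exists_sub_eq_deriv_mul {u u' : ℝ → ℝ} {T : ℝ}
    (hu : ∀ t ∈ Icc 0 T, HasDerivWithinAt u (u' t) (Icc 0 T) t) {t : ℝ} (ht : t ∈ Ioc 0 T) :
    ∃ c ∈ Ioo 0 t, u t - u 0 = u' c * t := by
  obtain ⟨c, hc, h⟩ := exists_hasDerivAt_eq_slope u u' ht.1
    (fun s hs => ((hu s ⟨hs.1, hs.2.trans ht.2⟩).mono
      (Icc_subset_Icc_right ht.2)).continuousWithinAt)
    (fun s hs => (hu s ⟨hs.1.le, hs.2.le.trans ht.2⟩).hasDerivAt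
      (Icc_mem_nhds hs.1 (hs.2.trans_le ht.2)))
  refine ⟨c, hc, ?_⟩
  have := ht.1.ne'
  rw [h, sub_zero]
  field_simp

lemma abs_sub_le_of_abs_deriv_le {u u' : ℝ → ℝ} {T M : ℝ}
    (hu : ∀ t ∈ Icc 0 T, HasDerivWithinAt u (u' t) (Icc 0 T) t)
    (hM : ∀ t ∈ Icc 0 T, |u' t| ≤ M) {t : ℝ} (ht : t ∈ Icc 0 T) : |u t - u 0| ≤ M * T := by
  have hM0 : 0 ≤ M := (abs_nonneg _).trans (hM t ht)
  rcases ht.1.eq_or_lt with rfl | h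
  · simpa using mul_nonneg hM0 ht.2
  · obtain ⟨c, hc, hcu⟩ := exists_sub_eq_deriv_mul hu ⟨h, ht.2⟩
    rw [hcu, abs_mul, abs_of_pos h]
    exact mul_le_mul (hM c ⟨hc.1.le, hc.2.le.trans ht.2⟩) ht.2 h.le hM0

/-- A relativistic particle subject to a bounded `T`-periodic force that points outwards
far away from the origin has a `T`-periodic motion. -/
theorem exists_periodic_motion {G : ℝ → ℝ → ℝ → ℝ} {T M A B : ℝ} {K : NNReal} (hT : 0 < T)
    (hG : Continuous fun z : ℝ × ℝ × ℝ => G z.1 z.2.1 z.2.2)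
    (hper : ∀ t q p, G (t + T) q p = G t q p)
    (hK : ∀ t ∈ Icc 0 T, LipschitzWith K fun z : ℝ × ℝ => G t z.1 z.2)
    (hM : ∀ t ∈ Icc 0 T, ∀ q p, |G t q p| ≤ M) (hAB : A ≤ B)
    (hA : ∀ t ∈ Icc 0 T, ∀ q ≤ A, ∀ p, G t q p < 0)
    (hB : ∀ t ∈ Icc 0 T, ∀ q ≥ B, ∀ p, 0 < G t q p) :
    ∃ q p : ℝ → ℝ, (∀ t, q (t + T) = q t) ∧ (∀ t, HasDerivAt q (relVelocity (p t)) t) ∧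
      ∀ t, HasDerivAt p (G t (q t) (p t)) t := by
  let V : ℝ → ℝ × ℝ → ℝ × ℝ := fun t z => (relVelocity z.2, G t z.1 z.2)
  have hM0 : 0 ≤ M := (abs_nonneg _).trans (hM 0 ⟨le_rfl, hT.le⟩ 0 0)
  have hV : Continuous fun z : ℝ × ℝ × ℝ => V z.1 z.2 :=
    ((contDiff_relVelocity (n := 0)).continuous.comp (by fun_prop)).prodMk hG
  obtain ⟨Φ, hΦ0, hΦ, hΦc⟩ := exists_continuous_flow (V := V) (K := max 1 K)
    (L := ⟨max 1 M, by positivity⟩) hT.le hV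
    (fun t ht => LipschitzWith.prodMk
      (by simpa using! lipschitzWith_relVelocity.comp LipschitzWith.prod_snd) (hK t ht))
    (fun t ht z => norm_prod_le_iff.2
      ⟨(abs_relVelocity_lt_one _).le.trans (le_max_left _ _), (hM t ht _ _).trans (le_max_right _ _)⟩)
  have hq : ∀ z, ∀ t ∈ Icc 0 T,
      HasDerivWithinAt (fun t => (Φ z t).1) (relVelocity (Φ z t).2) (Icc 0 T) t :=
    fun z t ht => (ContinuousLinearMap.fst ℝ ℝ ℝ).hasFDerivAt.comp_hasDerivWithinAt t (hΦ z t ht)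
  have hp : ∀ z, ∀ t ∈ Icc 0 T,
      HasDerivWithinAt (fun t => (Φ z t).2) (G t (Φ z t).1 (Φ z t).2) (Icc 0 T) t :=
    fun z t ht => (ContinuousLinearMap.snd ℝ ℝ ℝ).hasFDerivAt.comp_hasDerivWithinAt t (hΦ z t ht)
  have hqb : ∀ z, ∀ t ∈ Icc 0 T, |(Φ z t).1 - z.1| ≤ T := fun z t ht => by
    simpa [hΦ0] using abs_sub_le_of_abs_deriv_le (hq z)
      (fun s _ => (abs_relVelocity_lt_one (Φ z s).2).le) ht
  have hpb : ∀ z, ∀ t ∈ Icc 0 T, |(Φ z t).2 - z.2| ≤ M * T := fun z t ht => by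
    simpa [hΦ0] using abs_sub_le_of_abs_deriv_le (hp z) (fun s hs => hM s hs _ _) ht
  have hqm : ∀ z, ∃ c ∈ Icc 0 T, (Φ z T).1 - z.1 = relVelocity (Φ z c).2 * T := fun z => by
    obtain ⟨c, hc, h⟩ := exists_sub_eq_deriv_mul (hq z) ⟨hT, le_rfl⟩
    exact ⟨c, Ioo_subset_Icc_self hc, by simpa [hΦ0] using h⟩
  have hpm : ∀ z, ∃ c ∈ Icc 0 T, (Φ z T).2 - z.2 = G c (Φ z c).1 (Φ z c).2 * T := fun z => by
    obtain ⟨c, hc, h⟩ := exists_sub_eq_deriv_mul (hp z) ⟨hT, le_rfl⟩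
    exact ⟨c, Ioo_subset_Icc_self hc, by simpa [hΦ0] using h⟩
  have hMT : 0 ≤ M * T := by positivity
  obtain ⟨z, hz1, hz2⟩ := exists_zero_of_signs_on_rectangle
    (f := fun z => (Φ z T).2 - z.2) (g := fun z => (Φ z T).1 - z.1)
    (by fun_prop) (by fun_prop)
    (a := A - T) (b := B + T) (c := -(M * T + 1)) (d := M * T + 1) (by linarith) (by linarith)
    (fun y _ => by
      obtain ⟨c, hc, h⟩ := hpm (A - T, y)
      have := abs_le.1 (hqb (A - T, y) c hc)
      simp only at h this ⊢
      rw [h]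
      exact mul_neg_of_neg_of_pos (hA c hc _ (by linarith [this.2]) _) hT)
    (fun y _ => by
      obtain ⟨c, hc, h⟩ := hpm (B + T, y)
      have := abs_le.1 (hqb (B + T, y) c hc)
      simp only at h this ⊢
      rw [h]
      exact mul_pos (hB c hc _ (by linarith [this.1]) _) hT)
    (fun x _ => by
      obtain ⟨c, hc, h⟩ := hqm (x, -(M * T + 1))
      have := abs_le.1 (hpb (x, -(M * T + 1)) c hc)
      simp only at h this ⊢
      rw [h]
      have hpos := relVelocity_pos (p := -(Φ (x, -(M * T + 1)) c).2) (by linarith [this.2])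
      rw [relVelocity_neg] at hpos
      exact mul_neg_of_neg_of_pos (by linarith) hT)
    (fun x _ => by
      obtain ⟨c, hc, h⟩ := hqm (x, M * T + 1)
      have := abs_le.1 (hpb (x, M * T + 1) c hc)
      simp only at h this ⊢
      rw [h]
      exact mul_pos (relVelocity_pos (by linarith [this.1])) hT)
  obtain ⟨U, hUper, hU⟩ := exists_periodic_extension hT hV
    (fun t x => by simp only [V, hper]) (hΦ z)
    (by rw [hΦ0]; exact Prod.ext (sub_eq_zero.1 hz2).symm (sub_eq_zero.1 hz1).symm)
  exact ⟨fun t => (U t).1, fun t => (U t).2, fun t => congrArg Prod.fst (hUper t),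
    fun t => (ContinuousLinearMap.fst ℝ ℝ ℝ).hasFDerivAt.comp_hasDerivAt t (hU t),
    fun t => (ContinuousLinearMap.snd ℝ ℝ ℝ).hasFDerivAt.comp_hasDerivAt t (hU t)⟩

/-- Maximum principle: a periodic motion whose momentum increases whenever it is at rest
at a position `≥ b` stays below `b`. -/
theorem lt_of_momentum_deriv_pos {q p p' : ℝ → ℝ} {T b : ℝ} (hT : 0 < T)
    (hper : ∀ t, q (t + T) = q t) (hq : ∀ t, HasDerivAt q (relVelocity (p t)) t)
    (hp : ∀ t, HasDerivAt p (p' t) t) (h : ∀ t, b ≤ q t → p t = 0 → 0 < p' t) (t : ℝ) :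
    q t < b := by
  by_contra! hb
  have hqc : Continuous q := continuous_iff_continuousAt.2 fun t => (hq t).continuousAt
  obtain ⟨t₀, -, hmax⟩ := isCompact_Icc.exists_isMaxOn (nonempty_Icc.2 hT.le)
    (hqc.continuousOn (s := Icc 0 T))
  have hmax' : ∀ s, q s ≤ q t₀ := fun s => by
    obtain ⟨r, hr, hrs⟩ := (show Function.Periodic q T from hper).exists_mem_Ico₀ hT s
    rw [hrs]
    exact hmax (Ico_subset_Icc_self hr)
  have hp0 : p t₀ = 0 :=
    relVelocity_eq_zero.1 (IsLocalMax.hasDerivAt_eq_zero (Eventually.of_forall hmax') (hq t₀))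
  have hpos := h t₀ (hb.trans (hmax' t)) hp0
  have hev : ∀ᶠ s in 𝓝[>] t₀, 0 < p s := by
    have hslope := (hasDerivAt_iff_tendsto_slope.1 (hp t₀)).eventually (lt_mem_nhds hpos)
    filter_upwards [hslope.filter_mono (nhdsWithin_mono _ fun s hs => ne_of_gt hs),
      self_mem_nhdsWithin] with s hs hst
    rw [slope_def_field, hp0, sub_zero] at hs
    exact (div_pos_iff_of_pos_right (sub_pos.2 hst)).1 hs
  obtain ⟨t₁, ht₁, hsub⟩ := mem_nhdsGT_iff_exists_Ioo_subset.1 hev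
  obtain ⟨c, hc, hslope⟩ := exists_hasDerivAt_eq_slope q (fun t => relVelocity (p t)) ht₁
    hqc.continuousOn fun s _ => hq s
  have h1 := relVelocity_pos (hsub hc)
  rw [hslope, div_pos_iff_of_pos_right (sub_pos.2 ht₁)] at h1
  linarith [hmax' t₁]

end


/-- A forced relativistic particle with friction on a planar curve with
height function `y`, governed by `d/dt (q̇ / √(1 - q̇²)) = f(t, q, q̇) - γ q̇ - α y'(q)`,
has a `T`-periodic solution `q` with `q₁ < q(t) < q₂`, provided `y'(q₁) = 1`, `y'(q₂) = -1`,
and `f(t, q₁, 0) < α`, `f(t, q₂, 0) > -α` on `[0,T]`. -/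
theorem stmt_3 (T α γ : ℝ) (hT : 0 < T) (hα : 0 < α)
    (y : ℝ → ℝ) (hy : ContDiff ℝ 2 y) (f : ℝ → ℝ → ℝ → ℝ)
    (hf : ContDiff ℝ 1 (fun x : ℝ × ℝ × ℝ => f x.1 x.2.1 x.2.2))
    (hf_per : ∀ t q p, f (t + T) q p = f t q p)
    (q₁ q₂ : ℝ) (hq : q₁ < q₂) (hy₁ : deriv y q₁ = 1) (hy₂ : deriv y q₂ = -1)
    (hlow : ∀ t ∈ Set.Icc (0 : ℝ) T, f t q₁ 0 < α)
    (hhigh : ∀ t ∈ Set.Icc (0 : ℝ) T, f t q₂ 0 > -α) :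
    ∃ q : ℝ → ℝ, ContDiff ℝ 2 q ∧ (∀ t, q (t + T) = q t) ∧ (∀ t, |deriv q t| < 1) ∧
      (∀ t, HasDerivAt (fun s => deriv q s / Real.sqrt (1 - (deriv q s) ^ 2))
        (f t (q t) (deriv q t) - γ * deriv q t - α * deriv y (q t)) t) ∧
      (∀ t, q₁ < q t ∧ q t < q₂) := by
  let h : ℝ → ℝ → ℝ → ℝ := fun t q v => f t q v - γ * v - α * deriv y q
  have hdy : ContDiff ℝ 1 (deriv y) := ((contDiff_succ_iff_deriv (n := 1)).1 hy).2.2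
  have hh : ContDiff ℝ 1 fun z : ℝ × ℝ × ℝ => h z.1 z.2.1 z.2.2 := by
    have : ContDiff ℝ 1 fun z : ℝ × ℝ × ℝ => deriv y z.2.1 := hdy.comp (by fun_prop)
    exact (hf.sub (by fun_prop)).sub (contDiff_const.mul this)
  have hh_per : ∀ t q v, h (t + T) q v = h t q v := fun t q v => by simp only [h, hf_per]
  have hh₁ : ∀ t, h t q₁ 0 < 0 := fun t => by
    obtain ⟨s, hs, hst⟩ := Function.Periodic.exists_mem_Ico₀
      (f := fun t => h t q₁ 0) (fun t => hh_per t q₁ 0) hT t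
    simp only [h] at hst ⊢
    rw [hst, hy₁]
    linarith [hlow s (Set.Ico_subset_Icc_self hs)]
  have hh₂ : ∀ t, 0 < h t q₂ 0 := fun t => by
    obtain ⟨s, hs, hst⟩ := Function.Periodic.exists_mem_Ico₀
      (f := fun t => h t q₂ 0) (fun t => hh_per t q₂ 0) hT t
    simp only [h] at hst ⊢
    rw [hst, hy₂]
    linarith [hhigh s (Set.Ico_subset_Icc_self hs)]
  let S : Set (ℝ × ℝ × ℝ) := Set.Icc 0 T ×ˢ Set.Icc q₁ q₂ ×ˢ Set.Icc (-1) 1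
  have hS : IsCompact S := isCompact_Icc.prod (isCompact_Icc.prod isCompact_Icc)
  have hSc : Convex ℝ S := (convex_Icc _ _).prod ((convex_Icc _ _).prod (convex_Icc _ _))
  obtain ⟨M, hM⟩ := hS.exists_bound_of_continuousOn hh.continuous.continuousOn
  obtain ⟨K, hK⟩ := hh.contDiffOn.exists_lipschitzOnWith one_ne_zero hSc hS
  have hq' : q₁ - 1 ≤ q₂ + 1 := by linarith
  let c : ℝ → ℝ := fun x => Set.projIcc q₁ q₂ hq.le x
  let d : ℝ → ℝ := fun x => Set.projIcc (q₁ - 1) (q₂ + 1) hq' x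
  have hc : LipschitzWith 1 c := by
    simpa using! (LipschitzWith.subtype_val _).comp (LipschitzWith.projIcc hq.le)
  have hd : LipschitzWith 1 d := by
    simpa using! (LipschitzWith.subtype_val _).comp (LipschitzWith.projIcc hq')
  have hcmem : ∀ x, c x ∈ Set.Icc q₁ q₂ := fun x => (Set.projIcc q₁ q₂ hq.le x).2
  have hdmem : ∀ x, d x ∈ Set.Icc (q₁ - 1) (q₂ + 1) := fun x => (Set.projIcc _ _ hq' x).2
  have hc₁ : ∀ x ≤ q₁, c x = q₁ := fun x hx => by simp only [c, Set.projIcc_of_le_left _ hx]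
  have hc₂ : ∀ x, q₂ ≤ x → c x = q₂ := fun x hx => by
    simp only [c, Set.projIcc_of_right_le _ hx]
  have hmem : ∀ t ∈ Set.Icc 0 T, ∀ q p, (t, c q, relVelocity p) ∈ S := fun t ht q p =>
    ⟨ht, hcmem q, abs_le.1 (abs_relVelocity_lt_one p).le⟩
  have hb : ∀ t ∈ Set.Icc 0 T, ∀ q p, |h t (c q) (relVelocity p)| ≤ M := fun t ht q p =>
    hM _ (hmem t ht q p)
  have hM0 : 0 ≤ M := (abs_nonneg _).trans (hb 0 ⟨le_rfl, hT.le⟩ 0 0)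
  let G : ℝ → ℝ → ℝ → ℝ := fun t q p => h t (c q) (relVelocity p) + (M + 1) * (d q - c q)
  have hψ : Continuous relVelocity := (contDiff_relVelocity (n := 0)).continuous
  have hGc : Continuous fun z : ℝ × ℝ × ℝ => G z.1 z.2.1 z.2.2 := by
    have hcc := hc.continuous
    have hdc := hd.continuous
    have : Continuous fun z : ℝ × ℝ × ℝ => h z.1 (c z.2.1) (relVelocity z.2.2) :=
      hh.continuous.comp (g := fun z : ℝ × ℝ × ℝ => h z.1 z.2.1 z.2.2)
        (f := fun z : ℝ × ℝ × ℝ => (z.1, c z.2.1, relVelocity z.2.2)) (by fun_prop)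
    exact this.add (by fun_prop)
  have hhK : ∀ t ∈ Set.Icc 0 T, LipschitzWith (K * max 0 (max (1 * 1) (1 * 1)))
      fun z : ℝ × ℝ => h t (c z.1) (relVelocity z.2) := fun t ht => by
    rw [← lipschitzOnWith_univ]
    refine hK.comp (f := fun z : ℝ × ℝ => (t, c z.1, relVelocity z.2)) ?_
      fun z _ => hmem t ht _ _
    rw [lipschitzOnWith_univ]
    exact (LipschitzWith.const t).prodMk ((hc.comp LipschitzWith.prod_fst).prodMk
      (lipschitzWith_relVelocity.comp LipschitzWith.prod_snd))
  have hGK : ∃ K', ∀ t ∈ Set.Icc 0 T, LipschitzWith K' fun z : ℝ × ℝ => G t z.1 z.2 :=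
    ⟨_, fun t ht => (hhK t ht).add ((lipschitzWith_smul (M + 1)).comp
      ((hd.comp LipschitzWith.prod_fst).sub (hc.comp LipschitzWith.prod_fst)))⟩
  obtain ⟨K', hGK⟩ := hGK
  obtain ⟨q, p, hqper, hqd, hpd⟩ := exists_periodic_motion (G := G) (A := q₁ - 1) (B := q₂ + 1)
    (M := M + (M + 1) * (q₂ - q₁ + 2)) hT hGc
    (fun t q p => by simp only [G, hh_per]) hGK
    (fun t ht q p => (abs_add_le _ _).trans (add_le_add (hb t ht q p) (by
      rw [abs_mul, abs_of_pos (by linarith : 0 < M + 1)]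
      refine mul_le_mul_of_nonneg_left (abs_le.2 ⟨?_, ?_⟩) (by linarith) <;>
        linarith [(hcmem q).1, (hcmem q).2, (hdmem q).1, (hdmem q).2])))
    hq'
    (fun t ht q hq p => by
      have h1 := (abs_le.1 (hb t ht q p)).2
      have h2 : d q - c q = -1 := by
        rw [hc₁ q (by linarith)]
        simp only [d, Set.projIcc_of_le_left hq' hq]
        ring
      simp only [G, h2]
      linarith)
    (fun t ht q hq p => by
      have h1 := (abs_le.1 (hb t ht q p)).1
      have h2 : d q - c q = 1 := by
        rw [hc₂ q (by linarith)]
        simp only [d, Set.projIcc_of_right_le hq' hq]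
        ring
      simp only [G, h2]
      linarith)
  have hψ0 : relVelocity 0 = 0 := relVelocity_eq_zero.2 rfl
  have hlt : ∀ t, q t < q₂ := lt_of_momentum_deriv_pos hT hqper hqd hpd fun t hqt hpt => by
    have h1 : q₂ ≤ d (q t) := by
      simp only [d, Set.coe_projIcc]
      exact le_max_of_le_right (le_min (by linarith) hqt)
    simp only [G, hpt, hψ0, hc₂ _ hqt]
    have := mul_nonneg (by linarith : 0 ≤ M + 1) (sub_nonneg.2 h1)
    linarith [hh₂ t]
  have hgt : ∀ t, q₁ < q t := fun t => by
    refine neg_lt_neg_iff.1 (lt_of_momentum_deriv_pos (q := fun t => -q t) (p := fun t => -p t)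
      hT (fun t => by rw [hqper]) (fun t => by rw [relVelocity_neg]; exact (hqd t).neg)
      (fun t => (hpd t).neg) (fun t hqt hpt => ?_) t)
    have hqt' := neg_le_neg_iff.1 hqt
    have h1 : d (q t) ≤ q₁ := by
      simp only [d, Set.coe_projIcc]
      exact max_le (by linarith) (min_le_of_right_le hqt')
    simp only [G, neg_eq_zero.1 hpt, hψ0, hc₁ _ hqt']
    have := mul_nonneg (by linarith : 0 ≤ M + 1) (sub_nonneg.2 h1)
    linarith [hh₁ t]
  have hdq : deriv q = fun t => relVelocity (p t) := funext fun t => (hqd t).deriv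
  have hqc : Continuous q := continuous_iff_continuousAt.2 fun t => (hqd t).continuousAt
  have hpc : Continuous p := continuous_iff_continuousAt.2 fun t => (hpd t).continuousAt
  have hp1 : ContDiff ℝ 1 p := by
    refine contDiff_one_iff_deriv.2 ⟨fun t => (hpd t).differentiableAt, ?_⟩
    rw [funext fun t => (hpd t).deriv]
    exact hGc.comp (continuous_id.prodMk (hqc.prodMk hpc))
  refine ⟨q, ?_, hqper, fun t => ?_, fun t => ?_, fun t => ⟨hgt t, hlt t⟩⟩
  · refine (contDiff_succ_iff_deriv (n := 1)).2
      ⟨fun t => (hqd t).differentiableAt, by simp, ?_⟩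
    rw [hdq]
    exact contDiff_relVelocity.comp hp1
  · rw [hdq]
    exact abs_relVelocity_lt_one _
  · simp only [hdq, relVelocity_div_sqrt]
    convert hpd t using 1
    have h1 : c (q t) = q t := by
      simp only [c, Set.projIcc_of_mem hq.le ⟨(hgt t).le, (hlt t).le⟩]
    have h2 : d (q t) = q t := by
      simp only [d, Set.projIcc_of_mem hq' ⟨by linarith [hgt t], by linarith [hlt t]⟩]
    simp only [G, h1, h2, h]
    ring
end

section
/- Let T > 0, γ ∈ ℝ, let ψ : ℝ/Tℤ → ℝ be C² and f : ℝ/Tℤ → ℝ be C¹. Suppose |ψ̇(t)| < 1 and f(t) > |ψ̈(t)| (1 − ψ̇(t)²)^{−3/2} + |γ ψ̇(t)| for all t ∈ ℝ/Tℤ. Then the equation d/dt ( φ̇ / √(1 − φ̇²) ) = f(t) ( cos φ sin ψ(t) − sin φ cos ψ(t) ) − γ φ̇ has a T-periodic solution φ satisfying ψ(t) + π/2 < φ(t) < ψ(t) + 3π/2 for all t; in particular the particle follows the rotation of the force field. -/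
open Set Filter Topology

/-- A bounded vector field, Lipschitz in space uniformly in time and continuous in time, has global
solutions. -/
theorem exists_forall_hasDerivAt_of_lipschitz_of_bounded {E : Type*} [NormedAddCommGroup E]
    [NormedSpace ℝ E] [CompleteSpace E] {v : ℝ → E → E} {K L : NNReal}
    (hlip : ∀ t, LipschitzWith K (v t)) (hcont : ∀ x, Continuous fun t => v t x)
    (hbound : ∀ t x, ‖v t x‖ ≤ L) (x₀ : E) :
    ∃ α : ℝ → E, α 0 = x₀ ∧ ∀ t, HasDerivAt α (v t (α t)) t := by
  have hloc (n : ℕ) : ∃ α : ℝ → E, α 0 = x₀ ∧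
      ∀ t ∈ Ioo (-(n + 1 : ℝ)) (n + 1), HasDerivAt α (v t (α t)) t := by
    have h0 : (0 : ℝ) ∈ Icc (-(n + 1 : ℝ)) (n + 1) := by
      constructor <;> linarith [n.cast_nonneg (α := ℝ)]
    have hpl : IsPicardLindelof v (⟨0, h0⟩ : Icc (-(n + 1 : ℝ)) (n + 1)) x₀ (L * (n + 1)) 0 L K :=
      { lipschitzOnWith := fun t _ => (hlip t).lipschitzOnWith
        continuousOn := fun x _ => (hcont x).continuousOn
        norm_le := fun t _ x _ => hbound t x
        mul_max_le := by simp }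
    obtain ⟨α, h1, h2⟩ := hpl.exists_eq_forall_mem_Icc_hasDerivWithinAt₀
    exact ⟨α, h1, fun t ht => (h2 t (Ioo_subset_Icc_self ht)).hasDerivAt (Icc_mem_nhds ht.1 ht.2)⟩
  choose α hα0 hα using hloc
  have hle : ∀ m n : ℕ, m ≤ n → ∀ s : ℝ, |s| < m + 1 → α m s = α n s := by
    intro m n hmn s hs
    have hmn' : (m : ℝ) ≤ n := by exact_mod_cast hmn
    refine ODE_solution_unique_of_mem_Ioo (v := v) (s := fun _ => univ) (t₀ := 0) (K := K)
      (a := -(m + 1 : ℝ)) (b := m + 1)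
      (fun t _ => (hlip t).lipschitzOnWith) ?_ (fun t ht => ⟨hα m t ht, mem_univ _⟩)
      (fun t ht => ⟨hα n t ⟨by linarith [ht.1], by linarith [ht.2]⟩, mem_univ _⟩)
      ((hα0 m).trans (hα0 n).symm) (abs_lt.1 hs)
    constructor <;> linarith [m.cast_nonneg (α := ℝ)]
  have heq : ∀ m n : ℕ, ∀ s : ℝ, |s| < m + 1 → |s| < n + 1 → α m s = α n s := by
    intro m n s hm hn
    rcases le_total m n with h | h
    · exact hle m n h s hm
    · exact (hle n m h s hn).symm
  have hceil (s : ℝ) : |s| < (⌈|s|⌉₊ : ℝ) + 1 := by linarith [Nat.le_ceil |s|]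
  refine ⟨fun t => α ⌈|t|⌉₊ t, hα0 _, fun t => ?_⟩
  refine (hα ⌈|t|⌉₊ t (abs_lt.1 (hceil t))).congr_of_eventuallyEq ?_
  filter_upwards [continuous_abs.continuousAt.eventually_lt_const (hceil t)] with s hs
  exact heq _ _ s (hceil s) hs

theorem HasDerivAt.eventually_nhdsGT_lt {d : ℝ → ℝ} {c x : ℝ} (hd : HasDerivAt d c x)
    (hc : 0 < c) : ∀ᶠ s in 𝓝[>] x, d x < d s := by
  have h := (hd.tendsto_slope.mono_left (nhdsWithin_mono x fun y (hy : x < y) => hy.ne')).eventually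
    (lt_mem_nhds hc)
  filter_upwards [h, self_mem_nhdsWithin] with s hs hxs
  exact (slope_pos_iff_of_le (le_of_lt hxs)).1 hs

theorem HasDerivAt.eventually_nhdsLT_lt {d : ℝ → ℝ} {c x : ℝ} (hd : HasDerivAt d c x)
    (hc : 0 < c) : ∀ᶠ s in 𝓝[<] x, d s < d x := by
  have h := (hd.tendsto_slope.mono_left (nhdsWithin_mono x fun y (hy : y < x) => hy.ne)).eventually
    (lt_mem_nhds hc)
  filter_upwards [h, self_mem_nhdsWithin] with s hs hxs
  rw [slope_comm] at hs
  exact (slope_pos_iff_of_le (le_of_lt hxs)).1 hs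

/-- For the cooperative system `u' = g (w - γ u)`, `w' = F t u`, with `g` strictly increasing and
`F t` nondecreasing, raising the initial value of `w` strictly raises `u` at later times. -/
theorem lt_of_cooperative {g : ℝ → ℝ} {F : ℝ → ℝ → ℝ} {γ T : ℝ}
    (hg : StrictMono g) (hF : ∀ t, Monotone (F t)) (hT : 0 < T) {u₁ w₁ u₂ w₂ : ℝ → ℝ}
    (hu₁ : ∀ t, HasDerivAt u₁ (g (w₁ t - γ * u₁ t)) t) (hw₁ : ∀ t, HasDerivAt w₁ (F t (u₁ t)) t)
    (hu₂ : ∀ t, HasDerivAt u₂ (g (w₂ t - γ * u₂ t)) t) (hw₂ : ∀ t, HasDerivAt w₂ (F t (u₂ t)) t)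
    (hu : u₁ 0 = u₂ 0) (hw : w₁ 0 < w₂ 0) : u₁ T < u₂ T := by
  have hcu₁ : Continuous u₁ := continuous_iff_continuousAt.2 fun t => (hu₁ t).continuousAt
  have hcu₂ : Continuous u₂ := continuous_iff_continuousAt.2 fun t => (hu₂ t).continuousAt
  have hwlt : ∀ t, 0 ≤ t → (∀ s ∈ Icc 0 t, u₁ s ≤ u₂ s) → w₁ t < w₂ t := by
    intro t ht h
    have hmono : MonotoneOn (fun s => w₂ s - w₁ s) (Icc 0 t) := by
      refine monotoneOn_of_hasDerivWithinAt_nonneg (convex_Icc 0 t)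
        (f' := fun s => F s (u₂ s) - F s (u₁ s))
        (fun s _ => ((hw₂ s).sub (hw₁ s)).continuousAt.continuousWithinAt)
        (fun s _ => ((hw₂ s).sub (hw₁ s)).hasDerivWithinAt) fun s hs => ?_
      exact sub_nonneg.2 (hF s (h s (interior_subset hs)))
    have := hmono (left_mem_Icc.2 ht) (right_mem_Icc.2 ht) ht
    simp only at this
    linarith
  have hcross : ∀ t, 0 ≤ t → (∀ s ∈ Icc 0 t, u₁ s ≤ u₂ s) → u₁ t = u₂ t →
      0 < g (w₂ t - γ * u₂ t) - g (w₁ t - γ * u₁ t) := by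
    intro t ht h he
    refine sub_pos.2 (hg ?_)
    rw [he]
    linarith [hwlt t ht h]
  have hle : ∀ t ∈ Icc 0 T, u₁ t ≤ u₂ t := by
    by_contra! hneg
    set A : Set ℝ := {t | 0 ≤ t ∧ u₂ t < u₁ t}
    have hne : A.Nonempty := let ⟨t, ht, h⟩ := hneg; ⟨t, ht.1, h⟩
    have hbdd : BddBelow A := ⟨0, fun t ht => ht.1⟩
    set τ := sInf A
    have hτ0 : 0 ≤ τ := le_csInf hne fun t ht => ht.1
    have hbefore : ∀ s, 0 ≤ s → s < τ → u₁ s ≤ u₂ s := fun s hs hsτ =>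
      not_lt.1 fun h => hsτ.not_ge (csInf_le hbdd ⟨hs, h⟩)
    have hτge : u₂ τ ≤ u₁ τ := by
      have : τ ∈ closure A := csInf_mem_closure hne hbdd
      exact closure_minimal (fun t ht => ht.2.le) (isClosed_le hcu₂ hcu₁) this
    have hτle : u₁ τ ≤ u₂ τ := by
      rcases hτ0.eq_or_lt with h | h
      · rw [← h, hu]
      · have hcl : τ ∈ closure (Ico 0 τ) := by rw [closure_Ico h.ne]; exact right_mem_Icc.2 hτ0
        exact closure_minimal (fun s hs => hbefore s hs.1 hs.2) (isClosed_le hcu₁ hcu₂) hcl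
    have hbefore' : ∀ s ∈ Icc 0 τ, u₁ s ≤ u₂ s := fun s hs =>
      hs.2.eq_or_lt.elim (fun h => h ▸ hτle) (hbefore s hs.1)
    have hpos := hcross τ hτ0 hbefore' (le_antisymm hτle hτge)
    obtain ⟨z, hz, hzpos⟩ := (mem_nhdsGT_iff_exists_Ioo_subset).1
      (((hu₂ τ).sub (hu₁ τ)).eventually_nhdsGT_lt hpos)
    obtain ⟨t, htA, htz⟩ := exists_lt_of_csInf_lt hne (show sInf A < z from hz)
    rcases (csInf_le hbdd htA).eq_or_lt with h | h
    · exact htA.2.not_ge (h ▸ hτle)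
    · have := hzpos ⟨h, htz⟩
      simp only [mem_ofPred_eq, Pi.sub_apply] at this
      linarith [htA.2]
  by_contra! hge
  have hTe : u₁ T = u₂ T := le_antisymm (hle T (right_mem_Icc.2 hT.le)) hge
  have hpos := hcross T hT.le hle hTe
  obtain ⟨s, hs, hsT⟩ := ((((hu₂ T).sub (hu₁ T)).eventually_nhdsLT_lt hpos).and
    (Ico_mem_nhdsLT hT)).exists
  simp only [Pi.sub_apply] at hs
  linarith [hle s ⟨hsT.1, hsT.2.le⟩]

/-- If `Φ` is jointly continuous and `Φ c` is strictly increasing for every `c`, the solution `b` of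
`Φ c b = c` depends continuously on `c`. -/
theorem exists_continuous_of_strictMono {Φ : ℝ → ℝ → ℝ} (hΦ : Continuous fun p : ℝ × ℝ => Φ p.1 p.2)
    (hmono : ∀ c, StrictMono (Φ c)) (hsol : ∀ c, ∃ b, Φ c b = c) :
    ∃ B : ℝ → ℝ, Continuous B ∧ ∀ c, Φ c (B c) = c := by
  choose B hB using hsol
  refine ⟨B, continuous_iff_continuousAt.2 fun c => ?_, hB⟩
  have hs (b : ℝ) : ContinuousAt (fun c' => Φ c' b - c') c := by fun_prop
  refine tendsto_order.2 ⟨fun b hb => ?_, fun b hb => ?_⟩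
  · have h : Φ c b - c < 0 := by linarith [hmono c hb, hB c]
    filter_upwards [(hs b).eventually_lt_const h] with c' hc'
    rw [← (hmono c').lt_iff_lt, hB]
    linarith
  · have h : 0 < Φ c b - c := by linarith [hmono c hb, hB c]
    filter_upwards [(hs b).eventually_const_lt h] with c' hc'
    rw [← (hmono c').lt_iff_lt, hB]
    linarith

/-- Existence of a periodic solution of the cooperative system `u' = g (w - γ u)`, `w' = F t u`.
The problem `u 0 = u T = c` is solved by shooting in `w 0`, and then `c` is chosen by the intermediate
value theorem so that `w 0 = w T`. -/
theorem exists_periodic_of_cooperative {g : ℝ → ℝ} {F : ℝ → ℝ → ℝ} {γ T R : ℝ} {M : NNReal}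
    (hT : 0 < T) (hg : StrictMono g) (hg0 : g 0 = 0) (hglip : LipschitzWith 1 g)
    (hgb : ∀ y, |g y| ≤ 1) (hF : ∀ t, Monotone (F t)) (hFlip : ∀ t, LipschitzWith M (F t))
    (hFc : ∀ x, Continuous fun t => F t x) (hFb : ∀ t x, |F t x| ≤ M)
    (hFper : ∀ t x, F (t + T) x = F t x)
    (hFpos : ∀ t x, R ≤ x → 0 < F t x) (hFneg : ∀ t x, x ≤ -R → F t x < 0) :
    ∃ u w : ℝ → ℝ, (∀ t, HasDerivAt u (g (w t - γ * u t)) t) ∧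
      (∀ t, HasDerivAt w (F t (u t)) t) ∧ (∀ t, u (t + T) = u t) ∧ ∀ t, w (t + T) = w t := by
  set v : ℝ → ℝ × ℝ → ℝ × ℝ := fun t p => (g (p.2 - γ * p.1), F t p.1) with hv
  have hvlip (t : ℝ) : LipschitzWith (max (1 * (1 + ‖γ‖₊ * 1)) (M * 1)) (v t) := by
    refine LipschitzWith.prodMk (hglip.comp ?_) ((hFlip t).comp LipschitzWith.prod_fst)
    refine LipschitzWith.prod_snd.sub (LipschitzWith.comp ?_ LipschitzWith.prod_fst)
    exact LipschitzWith.of_dist_le_mul fun x y => by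
      rw [Real.dist_eq, Real.dist_eq, ← mul_sub, abs_mul]; simp
  have hvb (t : ℝ) (p : ℝ × ℝ) : ‖v t p‖ ≤ (max 1 M : NNReal) := by
    rw [NNReal.coe_max]
    exact max_le_max (hgb _) (hFb _ _)
  choose α hα0 hα using exists_forall_hasDerivAt_of_lipschitz_of_bounded hvlip
    (fun p => by simp only [hv]; exact continuous_const.prodMk (hFc _)) hvb
  have hu (p : ℝ × ℝ) (t : ℝ) : HasDerivAt (fun s => (α p s).1)
      (g ((α p t).2 - γ * (α p t).1)) t := (hα p t).fst
  have hw (p : ℝ × ℝ) (t : ℝ) : HasDerivAt (fun s => (α p s).2) (F t (α p t).1) t := (hα p t).snd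
  have hflow : Continuous fun p => α p T := by
    refine LipschitzWith.continuous (K := (Real.exp
      ((max (1 * (1 + ‖γ‖₊ * 1)) (M * 1) : NNReal) * (T - 0))).toNNReal)
      (LipschitzWith.of_dist_le_mul fun p q => ?_)
    rw [Real.coe_toNNReal _ (Real.exp_pos _).le, mul_comm]
    exact dist_le_of_trajectories_ODE hvlip
      (HasDerivAt.continuousOn fun t _ => hα p t) (fun t _ => (hα p t).hasDerivWithinAt)
      (HasDerivAt.continuousOn fun t _ => hα q t) (fun t _ => (hα q t).hasDerivWithinAt)
      (by rw [hα0, hα0]) T (right_mem_Icc.2 hT.le)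
  have hub (p : ℝ × ℝ) (t : ℝ) (ht : t ∈ Icc 0 T) : |(α p t).1 - p.1| ≤ T := by
    have := convex_univ.norm_image_sub_le_of_norm_hasDerivWithin_le (x := 0) (y := t)
      (fun s _ => (hu p s).hasDerivWithinAt) (fun s _ => hgb _) (mem_univ _) (mem_univ _)
    simp only [hα0, Real.norm_eq_abs, sub_zero, abs_of_nonneg ht.1] at this
    linarith [ht.2]
  have hwb (p : ℝ × ℝ) (t : ℝ) (ht : t ∈ Icc 0 T) : |(α p t).2 - p.2| ≤ M * T := by
    have := convex_univ.norm_image_sub_le_of_norm_hasDerivWithin_le (x := 0) (y := t)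
      (fun s _ => (hw p s).hasDerivWithinAt) (fun s _ => hFb _ _) (mem_univ _) (mem_univ _)
    simp only [hα0, Real.norm_eq_abs, sub_zero, abs_of_nonneg ht.1] at this
    exact this.trans (mul_le_mul_of_nonneg_left ht.2 M.2)
  have hsmono (c : ℝ) : StrictMono fun b => (α (c, b) T).1 := fun b b' hbb' =>
    lt_of_cooperative hg hF hT (hu _) (hw _) (hu _) (hw _) (by simp only [hα0]) (by simpa only [hα0])
  have hγ (p : ℝ × ℝ) (t : ℝ) (ht : t ∈ Icc 0 T) :
      |γ * (α p t).1 - γ * p.1| ≤ |γ| * T := by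
    rw [← mul_sub, abs_mul]
    exact mul_le_mul_of_nonneg_left (hub p t ht) (abs_nonneg _)
  have hsol (c : ℝ) : ∃ b, (α (c, b) T).1 = c := by
    have hcont : Continuous fun b => (α (c, b) T).1 := by fun_prop
    have hlow : (α (c, γ * c - (M * T + |γ| * T + 1)) T).1 ≤ c := by
      have hanti := antitoneOn_of_hasDerivWithinAt_nonpos (convex_Icc 0 T)
        (HasDerivAt.continuousOn fun t _ => hu (c, γ * c - (M * T + |γ| * T + 1)) t)
        (fun t _ => (hu _ t).hasDerivWithinAt) fun t ht => by
          have ht := interior_subset ht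
          rw [← hg0]
          refine hg.monotone ?_
          linarith [(abs_le.1 (hwb (c, γ * c - (M * T + |γ| * T + 1)) t ht)).2,
            (abs_le.1 (hγ (c, γ * c - (M * T + |γ| * T + 1)) t ht)).1]
      simpa [hα0] using hanti (left_mem_Icc.2 hT.le) (right_mem_Icc.2 hT.le) hT.le
    have hhigh : c ≤ (α (c, γ * c + (M * T + |γ| * T + 1)) T).1 := by
      have hmon := monotoneOn_of_hasDerivWithinAt_nonneg (convex_Icc 0 T)
        (HasDerivAt.continuousOn fun t _ => hu (c, γ * c + (M * T + |γ| * T + 1)) t)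
        (fun t _ => (hu _ t).hasDerivWithinAt) fun t ht => by
          have ht := interior_subset ht
          rw [← hg0]
          refine hg.monotone ?_
          linarith [(abs_le.1 (hwb (c, γ * c + (M * T + |γ| * T + 1)) t ht)).1,
            (abs_le.1 (hγ (c, γ * c + (M * T + |γ| * T + 1)) t ht)).2]
      simpa [hα0] using hmon (left_mem_Icc.2 hT.le) (right_mem_Icc.2 hT.le) hT.le
    exact mem_range_of_exists_le_of_exists_ge hcont ⟨_, hlow⟩ ⟨_, hhigh⟩
  obtain ⟨B, hBc, hB⟩ := exists_continuous_of_strictMono (Φ := fun c b => (α (c, b) T).1)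
    (continuous_fst.comp hflow) hsmono hsol
  have hDc : Continuous fun c => (α (c, B c) T).2 - B c := by fun_prop
  have hlow : (α (-R - T, B (-R - T)) T).2 - B (-R - T) ≤ 0 := by
    have hanti := antitoneOn_of_hasDerivWithinAt_nonpos (convex_Icc 0 T)
      (HasDerivAt.continuousOn fun t _ => hw (-R - T, B (-R - T)) t)
      (fun t _ => (hw _ t).hasDerivWithinAt) fun t ht => (hFneg t _ (by
        linarith [(abs_le.1 (hub (-R - T, B (-R - T)) t (interior_subset ht))).2])).le
    simpa [hα0] using hanti (left_mem_Icc.2 hT.le) (right_mem_Icc.2 hT.le) hT.le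
  have hhigh : 0 ≤ (α (R + T, B (R + T)) T).2 - B (R + T) := by
    have hmon := monotoneOn_of_hasDerivWithinAt_nonneg (convex_Icc 0 T)
      (HasDerivAt.continuousOn fun t _ => hw (R + T, B (R + T)) t)
      (fun t _ => (hw _ t).hasDerivWithinAt) fun t ht => (hFpos t _ (by
        linarith [(abs_le.1 (hub (R + T, B (R + T)) t (interior_subset ht))).1])).le
    simpa [hα0] using hmon (left_mem_Icc.2 hT.le) (right_mem_Icc.2 hT.le) hT.le
  obtain ⟨c, hc⟩ := mem_range_of_exists_le_of_exists_ge hDc ⟨_, hlow⟩ ⟨_, hhigh⟩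
  have hper : (fun t => α (c, B c) (t + T)) = α (c, B c) := by
    refine ODE_solution_unique_univ (t₀ := 0) (s := fun _ => univ)
      (fun t => (hvlip t).lipschitzOnWith) (fun t => ⟨?_, mem_univ _⟩)
      (fun t => ⟨hα _ t, mem_univ _⟩) ?_
    · have h := (hα (c, B c) (t + T)).comp_add_const t T
      simpa only [hv, hFper] using h
    · rw [zero_add, hα0]
      exact Prod.ext (hB c) (sub_eq_zero.1 hc)
  exact ⟨_, _, hu (c, B c), hw (c, B c), fun t => congrArg Prod.fst (congrFun hper t),
    fun t => congrArg Prod.snd (congrFun hper t)⟩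

/-- At a global minimum, the second derivative is nonnegative. -/
theorem nonneg_of_hasDerivAt_of_isMin {d d' : ℝ → ℝ} {c t₀ : ℝ} (hd : ∀ t, HasDerivAt d (d' t) t)
    (hd' : HasDerivAt d' c t₀) (hmin : ∀ t, d t₀ ≤ d t) : 0 ≤ c := by
  by_contra! hc
  have h0 : d' t₀ = 0 := IsLocalMin.hasDerivAt_eq_zero (.of_forall hmin) (hd t₀)
  obtain ⟨z, hz, hneg⟩ := (mem_nhdsGT_iff_exists_Ioo_subset).1
    (hd'.neg.eventually_nhdsGT_lt (neg_pos.2 hc))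
  have hanti : StrictAntiOn d (Icc t₀ z) := by
    refine strictAntiOn_of_hasDerivWithinAt_neg (convex_Icc t₀ z)
      (HasDerivAt.continuousOn fun t _ => hd t) (fun t _ => (hd t).hasDerivWithinAt) fun t ht => ?_
    rw [interior_Icc] at ht
    have := hneg ht
    simp only [mem_ofPred_eq, Pi.neg_apply, h0] at this
    linarith
  exact (hanti (left_mem_Icc.2 (le_of_lt hz)) (right_mem_Icc.2 (le_of_lt hz)) hz).not_ge (hmin z)

theorem Function.Periodic.exists_forall_le_of_continuous {d : ℝ → ℝ} {T : ℝ}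
    (hp : Function.Periodic d T) (hT : 0 < T) (hd : Continuous d) : ∃ t₀, ∀ t, d t₀ ≤ d t := by
  obtain ⟨t₀, -, h⟩ := isCompact_Icc.exists_isMinOn (nonempty_Icc.2 hT.le) hd.continuousOn
  refine ⟨t₀, fun t => ?_⟩
  obtain ⟨s, hs, hst⟩ := hp.exists_mem_Ico₀ hT t
  rw [hst]
  exact h (Ico_subset_Icc_self hs)

theorem Function.Periodic.exists_forall_abs_le_of_continuous {d : ℝ → ℝ} {T : ℝ}
    (hp : Function.Periodic d T) (hT : 0 < T) (hd : Continuous d) : ∃ M, ∀ t, |d t| ≤ M := by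
  obtain ⟨t₀, h⟩ := Function.Periodic.exists_forall_le_of_continuous (d := fun t => -|d t|)
    (fun t => by simp only [hp t]) hT (by fun_prop)
  exact ⟨_, fun t => neg_le_neg_iff.1 (h t)⟩

/-- The velocity of a relativistic particle of unit mass with momentum `y`. -/
noncomputable def relativisticVelocity (y : ℝ) : ℝ := y / √(1 + y ^ 2)

theorem one_sub_relativisticVelocity_sq (y : ℝ) :
    1 - relativisticVelocity y ^ 2 = (√(1 + y ^ 2) ^ 2)⁻¹ := by
  have h : 0 < 1 + y ^ 2 := by positivity
  rw [relativisticVelocity, div_pow, Real.sq_sqrt h.le]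
  field_simp
  ring

theorem abs_relativisticVelocity_lt_one (y : ℝ) : |relativisticVelocity y| < 1 := by
  rw [← sq_lt_one_iff_abs_lt_one, ← sub_pos, one_sub_relativisticVelocity_sq]
  positivity

theorem relativisticVelocity_div_sqrt (y : ℝ) :
    relativisticVelocity y / √(1 - relativisticVelocity y ^ 2) = y := by
  have h : 0 < √(1 + y ^ 2) := by positivity
  rw [one_sub_relativisticVelocity_sq, Real.sqrt_inv, Real.sqrt_sq h.le, relativisticVelocity]
  field_simp

theorem hasDerivAt_relativisticVelocity (y : ℝ) :
    HasDerivAt relativisticVelocity (√(1 + y ^ 2) ^ 3)⁻¹ y := by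
  have h : 0 < 1 + y ^ 2 := by positivity
  have hs : 0 < √(1 + y ^ 2) := by positivity
  have h1 : HasDerivAt (fun y : ℝ => 1 + y ^ 2) (2 * y) y := by
    simpa using (hasDerivAt_pow 2 y).const_add 1
  convert! (hasDerivAt_id y).div (h1.sqrt h.ne') hs.ne' using 1
  have h2 : √(1 + y ^ 2) ^ 2 = 1 + y ^ 2 := Real.sq_sqrt h.le
  simp only [id]
  field_simp
  rw [h2]
  ring

theorem strictMono_relativisticVelocity : StrictMono relativisticVelocity :=
  strictMono_of_hasDerivAt_pos hasDerivAt_relativisticVelocity fun y => by positivity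

theorem lipschitzWith_relativisticVelocity : LipschitzWith 1 relativisticVelocity := by
  refine lipschitzWith_of_nnnorm_deriv_le
    (fun y => (hasDerivAt_relativisticVelocity y).differentiableAt) fun y => ?_
  rw [(hasDerivAt_relativisticVelocity y).deriv, ← NNReal.coe_le_coe, coe_nnnorm,
    Real.norm_of_nonneg (by positivity)]
  exact inv_le_one_of_one_le₀ (one_le_pow₀ (Real.one_le_sqrt.2 (by nlinarith [sq_nonneg y])))

theorem contDiff_relativisticVelocity {n : ℕ∞} : ContDiff ℝ n relativisticVelocity := by
  refine contDiff_id.div (ContDiff.sqrt (by fun_prop) fun y => ?_) fun y => ?_ <;> positivity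

/-- The function `x ↦ -sin x`, restricted to `[π / 2, 3 π / 2]` and extended by constants. -/
noncomputable def truncatedNegSin (x : ℝ) : ℝ :=
  Real.sin (max (-(Real.pi / 2)) (min (x - Real.pi) (Real.pi / 2)))

theorem monotone_truncatedNegSin : Monotone truncatedNegSin := by
  have hmem (x : ℝ) : max (-(Real.pi / 2)) (min (x - Real.pi) (Real.pi / 2)) ∈
      Icc (-(Real.pi / 2)) (Real.pi / 2) :=
    ⟨le_max_left _ _, max_le (by linarith [Real.pi_pos]) (min_le_right _ _)⟩
  intro x y hxy
  exact Real.monotoneOn_sin (hmem x) (hmem y) (by gcongr)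

theorem lipschitzWith_truncatedNegSin : LipschitzWith 1 truncatedNegSin := by
  have h : LipschitzWith 1 fun x : ℝ => x - Real.pi :=
    LipschitzWith.of_dist_le_mul fun x y => by simp
  rw [← one_mul 1]
  exact Real.lipschitzWith_sin.comp ((h.min_const (Real.pi / 2)).const_max (-(Real.pi / 2)))

theorem abs_truncatedNegSin_le_one (x : ℝ) : |truncatedNegSin x| ≤ 1 := Real.abs_sin_le_one _

theorem truncatedNegSin_of_le {x : ℝ} (hx : x ≤ Real.pi / 2) : truncatedNegSin x = -1 := by
  rw [truncatedNegSin, max_eq_left, Real.sin_neg, Real.sin_pi_div_two]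
  exact (min_le_left _ _).trans (by linarith)

theorem truncatedNegSin_of_ge {x : ℝ} (hx : 3 * Real.pi / 2 ≤ x) : truncatedNegSin x = 1 := by
  rw [truncatedNegSin, min_eq_right (by linarith), max_eq_right (by linarith [Real.pi_pos]),
    Real.sin_pi_div_two]

theorem truncatedNegSin_of_mem {x : ℝ} (hx : x ∈ Icc (Real.pi / 2) (3 * Real.pi / 2)) :
    truncatedNegSin x = -Real.sin x := by
  rw [truncatedNegSin, min_eq_left (by linarith [hx.2]), max_eq_right (by linarith [hx.1]),
    Real.sin_sub_pi]

/-- The relativistic pendulum with friction in a rotating parallel force field,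
`d/dt (φ̇ / √(1 - φ̇²)) = f(t)(cos φ sin ψ(t) - sin φ cos ψ(t)) - γ φ̇`, with
`T`-periodic `ψ` (`C²`, `|ψ̇| < 1`) and `f` (`C¹`) satisfying
`f(t) > |ψ̈(t)|(1 - ψ̇(t)²)^{-3/2} + |γ ψ̇(t)|`, has a `T`-periodic solution `φ` with
`ψ(t) + π/2 < φ(t) < ψ(t) + 3π/2` for all `t`. -/
theorem stmt_4 (T γ : ℝ) (hT : 0 < T) (ψ f : ℝ → ℝ)
    (hψ : ContDiff ℝ 2 ψ) (hf : ContDiff ℝ 1 f)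
    (hψ_per : ∀ t, ψ (t + T) = ψ t) (hf_per : ∀ t, f (t + T) = f t)
    (hψ' : ∀ t, |deriv ψ t| < 1)
    (hbig : ∀ t, f t > |deriv (deriv ψ) t| * (1 - (deriv ψ t) ^ 2) ^ (-(3 : ℝ) / 2)
      + |γ * deriv ψ t|) :
    ∃ φ : ℝ → ℝ, ContDiff ℝ 2 φ ∧ (∀ t, φ (t + T) = φ t) ∧ (∀ t, |deriv φ t| < 1) ∧
      (∀ t, HasDerivAt (fun s => deriv φ s / Real.sqrt (1 - (deriv φ s) ^ 2))
        (f t * (Real.cos (φ t) * Real.sin (ψ t) - Real.sin (φ t) * Real.cos (ψ t))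
          - γ * deriv φ t) t) ∧
      (∀ t, ψ t + Real.pi / 2 < φ t ∧ φ t < ψ t + 3 * Real.pi / 2) := by
  have hfc := hf.continuous
  have hψc := hψ.continuous
  have hψd (t : ℝ) : HasDerivAt ψ (deriv ψ t) t :=
    (hψ.differentiable (by norm_num) t).hasDerivAt
  have hψdd (t : ℝ) : HasDerivAt (deriv ψ) (deriv (deriv ψ) t) t :=
    ((contDiff_succ_iff_deriv (n := 1).1 hψ).2.2.differentiable (by norm_num) t).hasDerivAt
  have hfpos (t : ℝ) : 0 < f t := by
    refine lt_of_le_of_lt ?_ (hbig t)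
    have : 0 ≤ 1 - deriv ψ t ^ 2 := by
      linarith [(sq_lt_one_iff_abs_lt_one _).2 (hψ' t)]
    positivity
  obtain ⟨M, hM⟩ := Function.Periodic.exists_forall_abs_le_of_continuous hf_per hT hfc
  obtain ⟨N, hN⟩ := Function.Periodic.exists_forall_abs_le_of_continuous hψ_per hT hψc
  have hM0 : 0 ≤ M := (abs_nonneg _).trans (hM 0)
  lift M to NNReal using hM0
  obtain ⟨u, w, hu, hw, hup, -⟩ := exists_periodic_of_cooperative
    (F := fun t x => f t * truncatedNegSin (x - ψ t)) (γ := γ) (R := N + 3 * Real.pi / 2) (M := M)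
    hT strictMono_relativisticVelocity (by simp [relativisticVelocity])
    lipschitzWith_relativisticVelocity (fun y => (abs_relativisticVelocity_lt_one y).le)
    (fun t x y hxy => mul_le_mul_of_nonneg_left
      (monotone_truncatedNegSin (sub_le_sub_right hxy _)) (hfpos t).le)
    (fun t => LipschitzWith.of_dist_le_mul fun x y => by
      rw [Real.dist_eq, ← mul_sub, abs_mul]
      have h := lipschitzWith_truncatedNegSin.dist_le_mul (x - ψ t) (y - ψ t)
      rw [dist_sub_right, NNReal.coe_one, one_mul, Real.dist_eq] at h
      exact mul_le_mul (hM t) h (abs_nonneg _) M.2)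
    (fun x => hfc.mul (lipschitzWith_truncatedNegSin.continuous.comp (by fun_prop)))
    (fun t x => by
      rw [abs_mul]
      simpa using mul_le_mul (hM t) (abs_truncatedNegSin_le_one _) (abs_nonneg _) M.2)
    (fun t x => by simp only [hf_per, hψ_per])
    (fun t x hx => by
      rw [truncatedNegSin_of_ge (by linarith [(abs_le.1 (hN t)).2]), mul_one]
      exact hfpos t)
    (fun t x hx => by
      rw [truncatedNegSin_of_le (by linarith [(abs_le.1 (hN t)).1, Real.pi_pos])]
      linarith [hfpos t])
  have hderiv : deriv u = fun t => relativisticVelocity (w t - γ * u t) :=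
    funext fun t => (hu t).deriv
  have hud : Differentiable ℝ u := fun t => (hu t).differentiableAt
  have hwd : Differentiable ℝ w := fun t => (hw t).differentiableAt
  have huc := hud.continuous
  have hwc := hwd.continuous
  have hy (t : ℝ) := (hw t).sub ((hu t).const_mul γ)
  have hv (t : ℝ) := (hasDerivAt_relativisticVelocity (w t - γ * u t)).comp t (hy t)
  have hdper : Function.Periodic (fun t => u t - ψ t) T := fun t => by simp only [hup, hψ_per]
  have hkey (t : ℝ) (ht : relativisticVelocity (w t - γ * u t) = deriv ψ t) :
      |deriv (deriv ψ) t| < (√(1 + (w t - γ * u t) ^ 2) ^ 3)⁻¹ * (f t - |γ * deriv ψ t|) := by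
    have h := hbig t
    set r := √(1 + (w t - γ * u t) ^ 2) with hr
    have hr0 : 0 < r := by positivity
    rw [← ht, one_sub_relativisticVelocity_sq, ← hr] at h
    have hpow : ((r ^ 2)⁻¹ : ℝ) ^ (-(3 : ℝ) / 2) = r ^ 3 := by
      rw [← Real.rpow_natCast r 2, ← Real.rpow_neg hr0.le, ← Real.rpow_mul hr0.le,
        ← Real.rpow_natCast r 3]
      norm_num
    rw [hpow] at h
    rw [← ht, lt_inv_mul_iff₀ (by positivity)]
    linarith
  have hlower (t : ℝ) : Real.pi / 2 < u t - ψ t := by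
    obtain ⟨t₀, ht₀⟩ := hdper.exists_forall_le_of_continuous hT (by fun_prop)
    refine lt_of_lt_of_le ?_ (ht₀ t)
    by_contra! hle
    have hcrit : relativisticVelocity (w t₀ - γ * u t₀) = deriv ψ t₀ := sub_eq_zero.1 <|
      IsLocalMin.hasDerivAt_eq_zero (.of_forall ht₀) ((hu t₀).sub (hψd t₀))
    have hc := nonneg_of_hasDerivAt_of_isMin (fun t => (hu t).sub (hψd t))
      ((hv t₀).sub (hψdd t₀)) ht₀
    rw [truncatedNegSin_of_le hle, hcrit] at hc
    have hneg : (√(1 + (w t₀ - γ * u t₀) ^ 2) ^ 3)⁻¹ * (f t₀ * -1 - γ * deriv ψ t₀) ≤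
        -((√(1 + (w t₀ - γ * u t₀) ^ 2) ^ 3)⁻¹ * (f t₀ - |γ * deriv ψ t₀|)) := by
      rw [← mul_neg]
      gcongr
      linarith [neg_abs_le (γ * deriv ψ t₀)]
    linarith [hkey t₀ hcrit, neg_abs_le (deriv (deriv ψ) t₀)]
  have hupper (t : ℝ) : u t - ψ t < 3 * Real.pi / 2 := by
    obtain ⟨t₀, ht₀⟩ := Function.Periodic.exists_forall_le_of_continuous
      (d := fun t => ψ t - u t) (fun t => by simp only [hup, hψ_per]) hT (by fun_prop)
    suffices h : u t₀ - ψ t₀ < 3 * Real.pi / 2 by linarith [ht₀ t]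
    by_contra! hge
    have hcrit : relativisticVelocity (w t₀ - γ * u t₀) = deriv ψ t₀ := Eq.symm <| sub_eq_zero.1 <|
      IsLocalMin.hasDerivAt_eq_zero (.of_forall ht₀) ((hψd t₀).sub (hu t₀))
    have hc := nonneg_of_hasDerivAt_of_isMin (fun t => (hψd t).sub (hu t))
      ((hψdd t₀).sub (hv t₀)) ht₀
    rw [truncatedNegSin_of_ge hge, hcrit, mul_one] at hc
    have hpos : (√(1 + (w t₀ - γ * u t₀) ^ 2) ^ 3)⁻¹ * (f t₀ - |γ * deriv ψ t₀|) ≤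
        (√(1 + (w t₀ - γ * u t₀) ^ 2) ^ 3)⁻¹ * (f t₀ - γ * deriv ψ t₀) := by
      gcongr
      exact le_abs_self _
    linarith [hkey t₀ hcrit, le_abs_self (deriv (deriv ψ) t₀)]
  have hC1 : ∀ {h h' : ℝ → ℝ}, (∀ t, HasDerivAt h (h' t) t) → Continuous h' → ContDiff ℝ 1 h :=
    fun {h h'} hd hc => contDiff_one_iff_deriv.2 ⟨fun t => (hd t).differentiableAt, by
      rwa [funext fun t => (hd t).deriv]⟩
  have hu1 : ContDiff ℝ 1 u :=
    hC1 hu (lipschitzWith_relativisticVelocity.continuous.comp (by fun_prop))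
  have hw1 : ContDiff ℝ 1 w :=
    hC1 hw (hfc.mul (lipschitzWith_truncatedNegSin.continuous.comp (by fun_prop)))
  refine ⟨u, ?_, hup, fun t => ?_, fun t => ?_, fun t => ?_⟩
  · refine (contDiff_succ_iff_deriv (n := 1)).2 ⟨hud, by simp, ?_⟩
    rw [hderiv]
    exact contDiff_relativisticVelocity.comp (by fun_prop)
  · rw [hderiv]
    exact abs_relativisticVelocity_lt_one _
  · simp only [hderiv, relativisticVelocity_div_sqrt]
    convert! hy t using 2
    rw [truncatedNegSin_of_mem ⟨(hlower t).le, (hupper t).le⟩, Real.sin_sub]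
    ring
  · constructor <;> linarith [hlower t, hupper t]
end

section
/- For the first-order system q̇ = p, ṗ = (1 − p²)^{3/2} f(t, q, p) with f : ℝ × ℝ × ℝ → ℝ continuous, the sets {p = 1} and {p = −1} are invariant: if (q, p) : I → ℝ² is a solution on an interval I and p(t₀) = 1 (respectively p(t₀) = −1) for some t₀ ∈ I, then p(t) = 1 (respectively p(t) = −1) for all t ∈ I. -/
open Set

/-- A curve on an interval whose derivative is bounded by a continuous multiple of its own norm
vanishes to the right of each of its zeros. -/
theorem eq_zero_of_norm_deriv_le_continuousOn_mul_norm_right {E : Type*} [NormedAddCommGroup E]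
    [NormedSpace ℝ E] {I : Set ℝ} (hI : I.OrdConnected) {h h' : ℝ → E} {B : ℝ → ℝ}
    (hB : ContinuousOn B I) (hh : ∀ t ∈ I, HasDerivWithinAt h (h' t) I t)
    (bound : ∀ t ∈ I, ‖h' t‖ ≤ B t * ‖h t‖) {a b : ℝ} (ha : a ∈ I) (hb : b ∈ I) (hab : a ≤ b)
    (h0 : h a = 0) : h b = 0 := by
  have hsub : Icc a b ⊆ I := hI.out ha hb
  obtain ⟨K, hK⟩ := isCompact_Icc.exists_bound_of_continuousOn (hB.mono hsub)
  refine eq_zero_of_abs_deriv_le_mul_abs_self_of_eq_zero_right (f' := h') (K := K)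
    (fun t ht => ((hh t (hsub ht)).mono hsub).continuousWithinAt) (fun t ht => ?_) h0
    (fun t ht => ?_) b (right_mem_Icc.2 hab)
  · refine (hh t (hsub (Ico_subset_Icc_self ht))).mono_of_mem_nhdsWithin ?_
    exact Filter.mem_of_superset (Icc_mem_nhdsGE ht.2) ((Icc_subset_Icc_left ht.1).trans hsub)
  · have ht' := Ico_subset_Icc_self ht
    exact (bound t (hsub ht')).trans (mul_le_mul_of_nonneg_right
      ((le_abs_self _).trans (hK t ht')) (norm_nonneg _))

/-- A curve on an interval whose derivative is bounded by a continuous multiple of its own norm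
vanishes identically as soon as it has a zero. -/
theorem eq_zero_of_norm_deriv_le_continuousOn_mul_norm {E : Type*} [NormedAddCommGroup E]
    [NormedSpace ℝ E] {I : Set ℝ} (hI : I.OrdConnected) {h h' : ℝ → E} {B : ℝ → ℝ}
    (hB : ContinuousOn B I) (hh : ∀ t ∈ I, HasDerivWithinAt h (h' t) I t)
    (bound : ∀ t ∈ I, ‖h' t‖ ≤ B t * ‖h t‖) {a b : ℝ} (ha : a ∈ I) (hb : b ∈ I)
    (h0 : h a = 0) : h b = 0 := by
  rcases le_total a b with hab | hba
  · exact eq_zero_of_norm_deriv_le_continuousOn_mul_norm_right hI hB hh bound ha hb hab h0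
  · have hmaps : MapsTo (fun t : ℝ => -t) ((fun t : ℝ => -t) ⁻¹' I) I := mapsTo_preimage _ _
    have key := eq_zero_of_norm_deriv_le_continuousOn_mul_norm_right
      (I := (fun t : ℝ => -t) ⁻¹' I) (h := fun t => h (-t)) (h' := fun t => -h' (-t))
      (B := fun t => B (-t)) (a := -a) (b := -b)
      ⟨fun x hx y hy z hz => hI.out hy hx ⟨neg_le_neg hz.2, neg_le_neg hz.1⟩⟩
      (hB.comp continuous_neg.continuousOn hmaps)
      (fun t ht => by
        simpa [Function.comp_def] using
          (hh (-t) ht).scomp t (hasDerivAt_neg t).hasDerivWithinAt hmaps)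
      (fun t ht => by simpa using bound (-t) ht)
      (by simpa using ha) (by simpa using hb) (neg_le_neg hba) (by simpa using h0)
    simpa using key

/-- For a negative base this uses the convention of `Real.rpow`. -/
theorem Real.abs_rpow_three_halves_le (x : ℝ) :
    |x ^ ((3 : ℝ) / 2)| ≤ |x| ^ ((1 : ℝ) / 2) * |x| := by
  refine (Real.abs_rpow_le_abs_rpow x _).trans_eq ?_
  rw [show (3 : ℝ) / 2 = 1 / 2 + 1 by norm_num,
    Real.rpow_add_one' (abs_nonneg x) (by norm_num)]

/-- For the first-order system `q̇ = p`, `ṗ = (1 - p²)^{3/2} f(t, q, p)`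
(`f` continuous), the sets `{p = 1}` and `{p = -1}` are invariant: if a solution on an
interval `I` has `p(t₀) = 1` (resp. `p(t₀) = -1`) at some `t₀ ∈ I`, then `p(t) = 1`
(resp. `p(t) = -1`) for all `t ∈ I`. -/
theorem stmt_5 (f : ℝ → ℝ → ℝ → ℝ)
    (hf : Continuous (fun x : ℝ × ℝ × ℝ => f x.1 x.2.1 x.2.2))
    (I : Set ℝ) (hI : I.OrdConnected) (q p : ℝ → ℝ)
    (hq : ∀ t ∈ I, HasDerivWithinAt q (p t) I t)
    (hp : ∀ t ∈ I, HasDerivWithinAt p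
      ((1 - (p t) ^ 2) ^ ((3 : ℝ) / 2) * f t (q t) (p t)) I t)
    (t₀ : ℝ) (ht₀ : t₀ ∈ I) :
    (p t₀ = 1 → ∀ t ∈ I, p t = 1) ∧ (p t₀ = -1 → ∀ t ∈ I, p t = -1) := by
  have hpc : ContinuousOn p I := fun t ht => (hp t ht).continuousWithinAt
  have hqc : ContinuousOn q I := fun t ht => (hq t ht).continuousWithinAt
  have hfc : ContinuousOn (fun t => f t (q t) (p t)) I :=
    hf.comp_continuousOn (continuousOn_id.prodMk (hqc.prodMk hpc))
  have invariant : ∀ c : ℝ, c ^ 2 = 1 → p t₀ = c → ∀ t ∈ I, p t = c := by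
    intro c hc h0 t ht
    refine sub_eq_zero.1 (eq_zero_of_norm_deriv_le_continuousOn_mul_norm hI
      (h := fun t => p t - c)
      (B := fun t => |1 - p t ^ 2| ^ ((1 : ℝ) / 2) * |p t + c| * |f t (q t) (p t)|) ?_
      (fun t ht => (hp t ht).sub_const c) (fun t _ => ?_) ht₀ ht (sub_eq_zero.2 h0))
    · refine ((ContinuousOn.rpow_const ?_ fun _ _ => Or.inr (by norm_num)).mul
        (hpc.add continuousOn_const).abs).mul hfc.abs
      exact (continuousOn_const.sub (hpc.pow 2)).abs
    · have hfac : |1 - p t ^ 2| = |p t + c| * |p t - c| := by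
        rw [← abs_mul, abs_sub_comm]
        congr 1
        linear_combination hc
      simp only [Real.norm_eq_abs, abs_mul]
      calc |(1 - p t ^ 2) ^ ((3 : ℝ) / 2)| * |f t (q t) (p t)|
          ≤ |1 - p t ^ 2| ^ ((1 : ℝ) / 2) * |1 - p t ^ 2| * |f t (q t) (p t)| :=
            mul_le_mul_of_nonneg_right (Real.abs_rpow_three_halves_le _) (abs_nonneg _)
        _ = |1 - p t ^ 2| ^ ((1 : ℝ) / 2) * (|p t + c| * |p t - c|) * |f t (q t) (p t)| := by
            rw [← hfac]
        _ = _ := by ring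
  exact ⟨invariant 1 (by norm_num), invariant (-1) (by norm_num)⟩
end

section
/- Let T > 0, γ ∈ ℝ, ψ : ℝ → ℝ be C² with |ψ̇(t)| < 1 for all t, and f : ℝ → ℝ satisfy f(t) > |ψ̈(t)| (1 − ψ̇(t)²)^{−3/2} + |γ ψ̇(t)| for all t. Then the functions h₁ = ψ + π/2 and h₂ = ψ + 3π/2 satisfy, for all t, (1 − ḣ₁(t)²)^{3/2} [ f(t)(cos h₁(t) sin ψ(t) − sin h₁(t) cos ψ(t)) − γ ḣ₁(t) ] − ḧ₁(t) = −(1 − ψ̇(t)²)^{3/2} ( f(t) + γ ψ̇(t) ) − ψ̈(t) < 0 and (1 − ḣ₂(t)²)^{3/2} [ f(t)(cos h₂(t) sin ψ(t) − sin h₂(t) cos ψ(t)) − γ ḣ₂(t) ] − ḧ₂(t) = (1 − ψ̇(t)²)^{3/2} ( f(t) − γ ψ̇(t) ) − ψ̈(t) > 0. -/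
/-- If `v` exceeds `|a| s ^ (-r) + |b|` with `s` positive, then `s ^ r * (v - |b|)` dominates `|a|`. -/
theorem abs_lt_rpow_mul_sub_abs {s r v a b : ℝ} (hs : 0 < s)
    (h : |a| * s ^ (-r) + |b| < v) : |a| < s ^ r * (v - |b|) := by
  have hp : 0 < s ^ r := Real.rpow_pos_of_pos hs r
  rw [Real.rpow_neg hs.le, ← div_eq_mul_inv, ← lt_sub_iff_add_lt, div_lt_iff₀ hp] at h
  rwa [mul_comm]

/-- For the relativistic pendulum in a rotating force field (barrier
verification): with `h₁ = ψ + π/2` and `h₂ = ψ + 3π/2`, the barrier expressions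
`(1 - ḣᵢ²)^{3/2}[f(t)(cos hᵢ sin ψ - sin hᵢ cos ψ) - γ ḣᵢ] - ḧᵢ` equal
`-(1 - ψ̇²)^{3/2}(f + γψ̇) - ψ̈ < 0` and `(1 - ψ̇²)^{3/2}(f - γψ̇) - ψ̈ > 0` respectively. -/
theorem stmt_10 (T γ : ℝ) (hT : 0 < T) (ψ f : ℝ → ℝ) (hψ : ContDiff ℝ 2 ψ)
    (hψ' : ∀ t, |deriv ψ t| < 1)
    (hbig : ∀ t, f t > |deriv (deriv ψ) t| * (1 - (deriv ψ t) ^ 2) ^ (-(3 : ℝ) / 2)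
      + |γ * deriv ψ t|)
    (h₁ h₂ : ℝ → ℝ) (hdef₁ : h₁ = fun t => ψ t + Real.pi / 2)
    (hdef₂ : h₂ = fun t => ψ t + 3 * Real.pi / 2) :
    ∀ t,
      ((1 - (deriv h₁ t) ^ 2) ^ ((3 : ℝ) / 2) *
          (f t * (Real.cos (h₁ t) * Real.sin (ψ t) - Real.sin (h₁ t) * Real.cos (ψ t))
            - γ * deriv h₁ t) - deriv (deriv h₁) t
        = -((1 - (deriv ψ t) ^ 2) ^ ((3 : ℝ) / 2) * (f t + γ * deriv ψ t))
            - deriv (deriv ψ) t ∧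
       (1 - (deriv h₁ t) ^ 2) ^ ((3 : ℝ) / 2) *
          (f t * (Real.cos (h₁ t) * Real.sin (ψ t) - Real.sin (h₁ t) * Real.cos (ψ t))
            - γ * deriv h₁ t) - deriv (deriv h₁) t < 0) ∧
      ((1 - (deriv h₂ t) ^ 2) ^ ((3 : ℝ) / 2) *
          (f t * (Real.cos (h₂ t) * Real.sin (ψ t) - Real.sin (h₂ t) * Real.cos (ψ t))
            - γ * deriv h₂ t) - deriv (deriv h₂) t
        = (1 - (deriv ψ t) ^ 2) ^ ((3 : ℝ) / 2) * (f t - γ * deriv ψ t)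
            - deriv (deriv ψ) t ∧
       (1 - (deriv h₂ t) ^ 2) ^ ((3 : ℝ) / 2) *
          (f t * (Real.cos (h₂ t) * Real.sin (ψ t) - Real.sin (h₂ t) * Real.cos (ψ t))
            - γ * deriv h₂ t) - deriv (deriv h₂) t > 0) := by
  intro t
  subst hdef₁ hdef₂
  have hd (c : ℝ) : deriv (fun t => ψ t + c) = deriv ψ := funext fun x => deriv_add_const c
  have hs : 0 < 1 - (deriv ψ t) ^ 2 := sub_pos.2 ((sq_lt_one_iff_abs_lt_one _).2 (hψ' t))
  have hp := Real.rpow_pos_of_pos hs (3 / 2)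
  have hdom := abs_lt_rpow_mul_sub_abs (r := 3 / 2) hs (by simpa only [neg_div] using hbig t)
  have hsin (c : ℝ) : Real.cos (ψ t + c) * Real.sin (ψ t) - Real.sin (ψ t + c) * Real.cos (ψ t)
      = -Real.sin c := by
    rw [← Real.sin_neg, show -c = ψ t - (ψ t + c) by ring, Real.sin_sub]
    ring
  have hsin₂ : Real.sin (3 * Real.pi / 2) = -1 := by
    rw [show 3 * Real.pi / 2 = Real.pi / 2 + Real.pi by ring, Real.sin_add_pi, Real.sin_pi_div_two]
  simp only [hd, hsin, hsin₂, Real.sin_pi_div_two]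
  have hlow := mul_le_mul_of_nonneg_left
    (add_le_add_right (neg_abs_le (γ * deriv ψ t)) (f t)) hp.le
  have hhigh := mul_le_mul_of_nonneg_left
    (sub_le_sub_left (le_abs_self (γ * deriv ψ t)) (f t)) hp.le
  have ha := le_abs_self (deriv (deriv ψ) t)
  have ha' := neg_abs_le (deriv (deriv ψ) t)
  refine ⟨⟨by ring, by linarith⟩, by ring, by linarith⟩
end
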